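/- arXiv:2012.15795 — 3 statements merged into one kernel-verified Lean document; each statement's English description precedes it below -/
import Mathlib

section
/- Let n ≥ 2 and let A be an antichain of A^n. (i) For a minimal element [i,i] of A^n: [i,i] ∈ LK(A) if and only if A contains no element [k,ℓ] with k ≤ i ≤ ℓ. (ii) For a non-minimal element [i,j] of A^n (i < j): [i,j] ∈ LK(A) if and only if [i, j−1] ∈ (Row_A^{−1} ∘ LK)(Ā), where Ā := {[a, b−1] : [a,b] ∈ A, a < b} is an antichain of A^{n−1}, and LK and Row_A^{−1} are taken in A^{n−1}. -/
/-- `p` represents an interval `[p.1, p.2]` of the poset `Aⁿ` (so `1 ≤ p.1 ≤ p.2 ≤ n`). -/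
def AnMem (n : ℕ) (p : ℕ × ℕ) : Prop := 1 ≤ p.1 ∧ p.1 ≤ p.2 ∧ p.2 ≤ n

/-- The containment order of `Aⁿ`: `AnLe p q` means `[p.1,p.2] ⊆ [q.1,q.2]`,
i.e. `p ≤ q` in `Aⁿ`. -/
def AnLe (p q : ℕ × ℕ) : Prop := q.1 ≤ p.1 ∧ p.2 ≤ q.2

/-- `A` is an antichain of the poset `Aⁿ`: its members are intervals of `[n]`, and no two
distinct members are comparable under containment. -/
def IsAntichainAn (n : ℕ) (A : Finset (ℕ × ℕ)) : Prop :=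
  (∀ p ∈ A, AnMem n p) ∧ ∀ p ∈ A, ∀ q ∈ A, p ≠ q → ¬ AnLe p q

/-- The Lalanne–Kreweras involution.  Writing the antichain `A` as
`{[i₁,j₁],…,[i_k,j_k]}` with `i₁ < ⋯ < i_k` and `j₁ < ⋯ < j_k`, the image `LK A` consists
of the pairs `[i'_ℓ, j'_ℓ]` where `{i'_1 < ⋯ < i'_m} = [n] \ {j₁,…,j_k}` and
`{j'_1 < ⋯ < j'_m} = [n] \ {i₁,…,i_k}`: we zip the increasing enumeration of the
complement of the second coordinates with that of the first coordinates. -/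
def LK (n : ℕ) (A : Finset (ℕ × ℕ)) : Finset (ℕ × ℕ) :=
  (List.zip
    ((Finset.Icc 1 n \ A.image Prod.snd).sort (· ≤ ·))
    ((Finset.Icc 1 n \ A.image Prod.fst).sort (· ≤ ·))).toFinset

instance (n : ℕ) (p : ℕ × ℕ) : Decidable (AnMem n p) := by unfold AnMem; infer_instance

instance (p q : ℕ × ℕ) : Decidable (AnLe p q) := by unfold AnLe; infer_instance

instance (n : ℕ) (A : Finset (ℕ × ℕ)) : Decidable (IsAntichainAn n A) := by
  unfold IsAntichainAn; infer_instance

/-- The set of elements of the poset `Aⁿ`, as a finset of pairs. -/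
def AnUniv (n : ℕ) : Finset (ℕ × ℕ) :=
  (Finset.Icc 1 n ×ˢ Finset.Icc 1 n).filter (AnMem n)

/-- Antichain rowmotion `Row_A` of `Aⁿ`: the image of an antichain `A` is the set of
minimal elements of `{x : x ≰ y for all y ∈ A}`. -/
def rowA (n : ℕ) (A : Finset (ℕ × ℕ)) : Finset (ℕ × ℕ) :=
  ((AnUniv n).filter (fun p => ∀ q ∈ A, ¬ AnLe p q)).filter
    (fun p => ∀ q ∈ (AnUniv n).filter (fun p' => ∀ q' ∈ A, ¬ AnLe p' q'),
      AnLe q p → q = p)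

theorem List.mem_zip_iff_countP_lt {l₁ l₂ : List ℕ} (h₁ : l₁.Pairwise (· < ·))
    (h₂ : l₂.Pairwise (· < ·)) (a b : ℕ) :
    (a, b) ∈ l₁.zip l₂ ↔
      a ∈ l₁ ∧ b ∈ l₂ ∧ l₁.countP (· < a) = l₂.countP (· < b) := by
  induction l₁ generalizing l₂ with
  | nil => simp
  | cons x l₁ ih =>
    cases l₂ with
    | nil => simp
    | cons y l₂ =>
      rw [List.pairwise_cons] at h₁ h₂
      have hx : ∀ c ≤ x, l₁.countP (· < c) = 0 := fun c hc => by
        rw [List.countP_eq_zero]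
        intro z hz
        have := h₁.1 z hz
        simp; omega
      have hy : ∀ c ≤ y, l₂.countP (· < c) = 0 := fun c hc => by
        rw [List.countP_eq_zero]
        intro z hz
        have := h₂.1 z hz
        simp; omega
      have ih' := ih h₁.2 h₂.2
      simp only [List.zip_cons_cons, List.mem_cons, Prod.mk.injEq, List.countP_cons,
        decide_eq_true_eq, ih']
      have hx' := hx a
      have hy' := hy b
      have ha := h₁.1 a
      have hb := h₂.1 b
      by_cases hax : a ∈ l₁ <;> by_cases hby : b ∈ l₂ <;> grind

theorem List.exists_mem_zip_iff_countP_lt {l₁ l₂ : List ℕ} (h₁ : l₁.Pairwise (· < ·))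
    (h₂ : l₂.Pairwise (· < ·)) (hl : l₁.length = l₂.length) (x y : ℕ) :
    (∃ q ∈ l₁.zip l₂, x ≤ q.1 ∧ q.2 ≤ y) ↔
      l₁.countP (· < x) < l₂.countP (· < y + 1) := by
  induction l₁ generalizing l₂ with
  | nil => cases l₂ <;> simp_all
  | cons a l₁ ih =>
    cases l₂ with
    | nil => simp at hl
    | cons b l₂ =>
      rw [List.pairwise_cons] at h₁ h₂
      have ih' := ih h₁.2 h₂.2 (by simpa using hl)
      simp only [List.zip_cons_cons, List.exists_mem_cons_iff, ih', List.countP_cons,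
        decide_eq_true_eq]
      have ha : x ≤ a → l₁.countP (· < x) = 0 := fun hc => by
        rw [List.countP_eq_zero]
        intro z hz
        have := h₁.1 z hz
        simp; omega
      have hb : y < b → l₂.countP (· < y + 1) = 0 := fun hc => by
        rw [List.countP_eq_zero]
        intro z hz
        have := h₂.1 z hz
        simp; omega
      split_ifs <;> omega

theorem Finset.countP_sort_lt (S : Finset ℕ) (a : ℕ) :
    (S.sort (· ≤ ·)).countP (· < a) = (S.filter (· < a)).card := by
  have h : (S.sort (· ≤ ·)).countP (· < a) = Multiset.countP (· < a) S.val := by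
    rw [← Finset.sort_eq S (· ≤ ·), Multiset.coe_countP]
  rw [h, Multiset.countP_eq_card_filter]
  rfl

/-- The number of elements `p` of `A` with `h p < x`. -/
def countBelow (A : Finset (ℕ × ℕ)) (h : ℕ × ℕ → ℕ) (x : ℕ) : ℕ :=
  (A.filter (fun p => h p < x)).card

theorem countBelow_mono (A : Finset (ℕ × ℕ)) (h : ℕ × ℕ → ℕ) {x y : ℕ} (hxy : x ≤ y) :
    countBelow A h x ≤ countBelow A h y := by
  apply Finset.card_le_card
  intro p
  simp only [Finset.mem_filter]
  exact fun hp => ⟨hp.1, hp.2.trans_le hxy⟩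

theorem countBelow_succ {A : Finset (ℕ × ℕ)} {h : ℕ × ℕ → ℕ} (hinj : Set.InjOn h A) (x : ℕ) :
    countBelow A h (x + 1) = countBelow A h x + if x ∈ A.image h then 1 else 0 := by
  have hsplit : A.filter (fun p => h p < x + 1)
      = A.filter (fun p => h p < x) ∪ A.filter (fun p => h p = x) := by
    ext p; simp only [Finset.mem_filter, Finset.mem_union]; grind
  have hdisj : Disjoint (A.filter (fun p => h p < x)) (A.filter (fun p => h p = x)) := by
    rw [Finset.disjoint_filter]; intro p _; omega
  unfold countBelow
  rw [hsplit, Finset.card_union_of_disjoint hdisj]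
  congr 1
  split_ifs with hx
  · obtain ⟨p, hp, rfl⟩ := Finset.mem_image.1 hx
    rw [Finset.card_eq_one]
    refine ⟨p, ?_⟩
    ext q
    simp only [Finset.mem_filter, Finset.mem_singleton]
    exact ⟨fun hq => hinj hq.1 hp hq.2, by rintro rfl; exact ⟨hp, rfl⟩⟩
  · rw [Finset.card_eq_zero, Finset.filter_eq_empty_iff]
    exact fun p hp hpx => hx (Finset.mem_image.2 ⟨p, hp, hpx⟩)

theorem countBelow_add_le {A : Finset (ℕ × ℕ)} {h : ℕ × ℕ → ℕ} (hinj : Set.InjOn h A)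
    {x y : ℕ} (hxy : x ≤ y) : countBelow A h y + x ≤ countBelow A h x + y := by
  induction y, hxy using Nat.le_induction with
  | base => exact le_rfl
  | succ y _ ih =>
    rw [countBelow_succ hinj]
    split_ifs <;> omega

theorem card_filter_compl_add_countBelow {n : ℕ} {A : Finset (ℕ × ℕ)} {h : ℕ × ℕ → ℕ}
    (hinj : Set.InjOn h A) (hpos : ∀ p ∈ A, 1 ≤ h p) {a : ℕ} (ha : 1 ≤ a) (han : a ≤ n + 1) :
    ((Finset.Icc 1 n \ A.image h).filter (· < a)).card + countBelow A h a + 1 = a := by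
  induction a, ha using Nat.le_induction with
  | base =>
    have h0 : countBelow A h 1 = 0 := by
      rw [countBelow, Finset.card_eq_zero, Finset.filter_eq_empty_iff]
      intro p hp; have := hpos p hp; omega
    have h1 : (Finset.Icc 1 n \ A.image h).filter (· < 1) = ∅ := by
      rw [Finset.filter_eq_empty_iff]
      intro x hx
      simp only [Finset.mem_sdiff, Finset.mem_Icc] at hx; omega
    rw [h0, h1]; rfl
  | succ a ha ih =>
    have ih := ih (by omega)
    rw [countBelow_succ hinj]
    by_cases hx : a ∈ A.image h
    · have : (Finset.Icc 1 n \ A.image h).filter (· < a + 1)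
          = (Finset.Icc 1 n \ A.image h).filter (· < a) := by
        ext x; simp only [Finset.mem_filter, Finset.mem_sdiff]; grind
      rw [this, if_pos hx]; omega
    · have : (Finset.Icc 1 n \ A.image h).filter (· < a + 1)
          = insert a ((Finset.Icc 1 n \ A.image h).filter (· < a)) := by
        ext x
        simp only [Finset.mem_filter, Finset.mem_sdiff, Finset.mem_insert, Finset.mem_Icc]
        grind
      rw [this, if_neg hx, Finset.card_insert_of_notMem (by simp)]; omega

namespace IsAntichainAn

variable {n : ℕ} {A : Finset (ℕ × ℕ)}

theorem eq_of_anLe (hA : IsAntichainAn n A) {p q : ℕ × ℕ} (hp : p ∈ A) (hq : q ∈ A)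
    (h : AnLe p q) : p = q :=
  by_contra fun hne => hA.2 p hp q hq hne h

theorem injOn_fst (hA : IsAntichainAn n A) : Set.InjOn Prod.fst (A : Set (ℕ × ℕ)) := by
  intro p hp q hq h
  rcases le_total p.2 q.2 with h2 | h2
  · exact hA.eq_of_anLe hp hq ⟨h.ge, h2⟩
  · exact (hA.eq_of_anLe hq hp ⟨h.le, h2⟩).symm

theorem injOn_snd (hA : IsAntichainAn n A) : Set.InjOn Prod.snd (A : Set (ℕ × ℕ)) := by
  intro p hp q hq h
  rcases le_total q.1 p.1 with h1 | h1
  · exact hA.eq_of_anLe hp hq ⟨h1, h.le⟩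
  · exact (hA.eq_of_anLe hq hp ⟨h1, h.ge⟩).symm

theorem card_compl_fst (hA : IsAntichainAn n A) {a : ℕ} (ha : 1 ≤ a) (han : a ≤ n + 1) :
    ((Finset.Icc 1 n \ A.image Prod.fst).filter (· < a)).card
      + countBelow A Prod.fst a + 1 = a :=
  card_filter_compl_add_countBelow hA.injOn_fst (fun p hp => (hA.1 p hp).1) ha han

theorem card_compl_snd (hA : IsAntichainAn n A) {a : ℕ} (ha : 1 ≤ a) (han : a ≤ n + 1) :
    ((Finset.Icc 1 n \ A.image Prod.snd).filter (· < a)).card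
      + countBelow A Prod.snd a + 1 = a :=
  card_filter_compl_add_countBelow hA.injOn_snd
    (fun p hp => (hA.1 p hp).1.trans (hA.1 p hp).2.1) ha han

theorem mem_LK_iff (hA : IsAntichainAn n A) {a b : ℕ} (ha : 1 ≤ a) (han : a ≤ n) (hb : 1 ≤ b)
    (hbn : b ≤ n) :
    (a, b) ∈ LK n A ↔ a ∉ A.image Prod.snd ∧ b ∉ A.image Prod.fst ∧
      a + countBelow A Prod.fst b = b + countBelow A Prod.snd a := by
  rw [LK, List.mem_toFinset, List.mem_zip_iff_countP_lt (Finset.sortedLT_sort _).pairwise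
    (Finset.sortedLT_sort _).pairwise, Finset.countP_sort_lt, Finset.countP_sort_lt,
    Finset.mem_sort, Finset.mem_sort, Finset.mem_sdiff, Finset.mem_sdiff, Finset.mem_Icc,
    Finset.mem_Icc]
  have h1 := hA.card_compl_snd ha (by omega)
  have h2 := hA.card_compl_fst hb (by omega)
  constructor
  · rintro ⟨h3, h4, h5⟩; exact ⟨h3.2, h4.2, by omega⟩
  · rintro ⟨h3, h4, h5⟩; exact ⟨⟨⟨ha, han⟩, h3⟩, ⟨⟨hb, hbn⟩, h4⟩, by omega⟩

theorem countBelow_fst_top (hA : IsAntichainAn n A) : countBelow A Prod.fst (n + 1) = A.card := by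
  rw [countBelow, Finset.filter_true_of_mem]
  intro p hp; have := hA.1 p hp; unfold AnMem at this; omega

theorem countBelow_snd_top (hA : IsAntichainAn n A) : countBelow A Prod.snd (n + 1) = A.card := by
  rw [countBelow, Finset.filter_true_of_mem]
  intro p hp; have := hA.1 p hp; unfold AnMem at this; omega

theorem exists_mem_LK_anLe_iff (hA : IsAntichainAn n A) {x y : ℕ} (hx : 1 ≤ x) (hxn : x ≤ n)
    (hyn : y ≤ n) :
    (∃ q ∈ LK n A, AnLe q (x, y)) ↔
      x + countBelow A Prod.fst (y + 1) < y + 1 + countBelow A Prod.snd x := by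
  have hcard : (Finset.Icc 1 n \ A.image Prod.snd).card
      = (Finset.Icc 1 n \ A.image Prod.fst).card := by
    have h1 := hA.card_compl_snd (a := n + 1) (by omega) le_rfl
    have h2 := hA.card_compl_fst (a := n + 1) (by omega) le_rfl
    rw [hA.countBelow_snd_top, Finset.filter_true_of_mem] at h1
    · rw [hA.countBelow_fst_top, Finset.filter_true_of_mem] at h2
      · omega
      · intro z hz; simp only [Finset.mem_sdiff, Finset.mem_Icc] at hz; omega
    · intro z hz; simp only [Finset.mem_sdiff, Finset.mem_Icc] at hz; omega
  have key := List.exists_mem_zip_iff_countP_lt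
    (Finset.sortedLT_sort (Finset.Icc 1 n \ A.image Prod.snd)).pairwise
    (Finset.sortedLT_sort (Finset.Icc 1 n \ A.image Prod.fst)).pairwise
    (by simpa using hcard) x y
  simp only [LK, List.mem_toFinset, AnLe]
  rw [key, Finset.countP_sort_lt, Finset.countP_sort_lt]
  have h1 := hA.card_compl_snd hx (by omega)
  have h2 := hA.card_compl_fst (a := y + 1) (by omega) (by omega)
  omega

end IsAntichainAn

theorem AnLe.trans {p q r : ℕ × ℕ} (h : AnLe p q) (h' : AnLe q r) : AnLe p r :=
  ⟨h'.1.trans h.1, h.2.trans h'.2⟩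

theorem AnLe.refl (p : ℕ × ℕ) : AnLe p p := ⟨le_rfl, le_rfl⟩

theorem AnLe.antisymm {p q : ℕ × ℕ} (h : AnLe p q) (h' : AnLe q p) : p = q :=
  Prod.ext (le_antisymm h'.1 h.1) (le_antisymm h.2 h'.2)

theorem mem_AnUniv {n : ℕ} {p : ℕ × ℕ} : p ∈ AnUniv n ↔ AnMem n p := by
  simp only [AnUniv, Finset.mem_filter, Finset.mem_product, Finset.mem_Icc, AnMem]; omega

theorem mem_rowA {n : ℕ} {B : Finset (ℕ × ℕ)} {p : ℕ × ℕ} :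
    p ∈ rowA n B ↔ AnMem n p ∧ (∀ q ∈ B, ¬ AnLe p q) ∧
      ∀ q, AnMem n q → (∀ r ∈ B, ¬ AnLe q r) → AnLe q p → q = p := by
  simp only [rowA, Finset.mem_filter, mem_AnUniv, and_assoc, and_imp]

theorem exists_mem_rowA_anLe_iff {n : ℕ} {B : Finset (ℕ × ℕ)} {p : ℕ × ℕ} (hp : AnMem n p) :
    (∃ q ∈ rowA n B, AnLe q p) ↔ ∀ r ∈ B, ¬ AnLe p r := by
  constructor
  · rintro ⟨q, hq, hqp⟩ r hr hpr
    exact (mem_rowA.1 hq).2.1 r hr (hqp.trans hpr)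
  · intro h
    induction hs : p.2 - p.1 using Nat.strong_induction_on generalizing p with
    | _ s ih =>
      by_cases hmin : ∀ q, AnMem n q → (∀ r ∈ B, ¬ AnLe q r) → AnLe q p → q = p
      · exact ⟨p, mem_rowA.2 ⟨hp, h, hmin⟩, AnLe.refl p⟩
      · push Not at hmin
        obtain ⟨q, hq, hqB, hqp, hne⟩ := hmin
        have hlt : q.2 - q.1 < s := by
          have hne' : ¬ (q.1 = p.1 ∧ q.2 = p.2) := fun h => hne (Prod.ext h.1 h.2)
          unfold AnMem AnLe at *
          omega
        obtain ⟨t, ht, htq⟩ := ih _ hlt hq hqB rfl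
        exact ⟨t, ht, htq.trans hqp⟩

theorem IsAntichainAn.mem_iff_maximal_not_above_rowA {n : ℕ} {B : Finset (ℕ × ℕ)}
    (hB : IsAntichainAn n B) {p : ℕ × ℕ} (hp : AnMem n p) :
    p ∈ B ↔ (¬ ∃ q ∈ rowA n B, AnLe q p) ∧
      ∀ p', AnMem n p' → AnLe p p' → (¬ ∃ q ∈ rowA n B, AnLe q p') → p' = p := by
  constructor
  · intro hpB
    refine ⟨?_, fun p' hp' hpp' h => ?_⟩
    · rw [exists_mem_rowA_anLe_iff hp]
      exact fun h => h p hpB (AnLe.refl p)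
    · rw [exists_mem_rowA_anLe_iff hp'] at h
      push Not at h
      obtain ⟨r, hr, hpr⟩ := h
      obtain rfl := hB.eq_of_anLe hpB hr (hpp'.trans hpr)
      exact hpr.antisymm hpp'
  · rintro ⟨h, hmax⟩
    rw [exists_mem_rowA_anLe_iff hp] at h
    push Not at h
    obtain ⟨r, hr, hpr⟩ := h
    rw [← hmax r (hB.1 r hr) hpr ?_]
    · exact hr
    · rw [exists_mem_rowA_anLe_iff (hB.1 r hr)]
      exact fun h => h r hr (AnLe.refl r)

/-- If `Row_A B = LK D`, then `B` consists of the maximal elements which are not above any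
element of `LK D`; it suffices to test maximality on the two elements covering a given one. -/
theorem IsAntichainAn.mem_iff_of_rowA_eq_LK {m : ℕ} {B D : Finset (ℕ × ℕ)}
    (hB : IsAntichainAn m B) (hD : IsAntichainAn m D) (h : rowA m B = LK m D) {x y : ℕ}
    (hx : 1 ≤ x) (hxy : x ≤ y) (hy : y ≤ m) :
    (x, y) ∈ B ↔
      y + 1 + countBelow D Prod.snd x ≤ x + countBelow D Prod.fst (y + 1) ∧
      (1 < x → x - 1 + countBelow D Prod.fst (y + 1) < y + 1 + countBelow D Prod.snd (x - 1)) ∧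
      (y < m → x + countBelow D Prod.fst (y + 2) < y + 2 + countBelow D Prod.snd x) := by
  rw [hB.mem_iff_maximal_not_above_rowA ⟨hx, hxy, hy⟩, h,
    hD.exists_mem_LK_anLe_iff hx (by omega) hy, not_lt]
  refine and_congr_right fun _ => ⟨fun hmax => ⟨fun hx1 => ?_, fun hym => ?_⟩, ?_⟩
  · rw [← hD.exists_mem_LK_anLe_iff (by omega) (by omega) hy]
    by_contra hno
    have := hmax (x - 1, y) ⟨by simp; omega, by simp; omega, hy⟩ ⟨by simp, le_rfl⟩ hno
    simp only [Prod.mk.injEq] at this; omega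
  · rw [← hD.exists_mem_LK_anLe_iff (y := y + 1) (by omega) (by omega) (by omega)]
    by_contra hno
    have := hmax (x, y + 1) ⟨hx, by simp; omega, hym⟩ ⟨le_rfl, by simp⟩ hno
    simp at this
  · rintro ⟨h1, h2⟩ ⟨x', y'⟩ ⟨hx', hxy', hy'⟩ ⟨hxx', hyy'⟩ hno
    simp only at hx' hxy' hy' hxx' hyy'
    by_contra hne
    rcases Nat.lt_or_ge x' x with hlt | hge
    · obtain ⟨q, hq, hle⟩ := (hD.exists_mem_LK_anLe_iff (x := x - 1) (y := y) (by omega)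
        (by omega) hy).2 (h1 (by omega))
      exact hno ⟨q, hq, hle.trans ⟨by simp; omega, hyy'⟩⟩
    · have hlt : y < y' := by
        by_contra hcon
        exact hne (Prod.ext (by simp; omega) (by simp; omega))
      obtain ⟨q, hq, hle⟩ := (hD.exists_mem_LK_anLe_iff (x := x) (y := y + 1) hx
        (by omega) (by omega)).2 (h2 (by omega))
      exact hno ⟨q, hq, hle.trans ⟨hxx', hlt⟩⟩

/-- The antichain `Ā` of `A^(n-1)` obtained from `A` by deleting the minimal elements and
shortening the other intervals by one. -/
def shorten (A : Finset (ℕ × ℕ)) : Finset (ℕ × ℕ) :=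
  (A.filter (fun p => p.1 < p.2)).image (fun p => (p.1, p.2 - 1))

namespace IsAntichainAn

variable {n : ℕ} {A : Finset (ℕ × ℕ)}

protected theorem shorten (hA : IsAntichainAn n A) : IsAntichainAn (n - 1) (shorten A) := by
  constructor
  · intro p hp
    simp only [shorten, Finset.mem_image, Finset.mem_filter] at hp
    obtain ⟨q, ⟨hq, hlt⟩, rfl⟩ := hp
    have := hA.1 q hq
    unfold AnMem at *
    simp only
    omega
  · intro p hp p' hp' hne hle
    simp only [shorten, Finset.mem_image, Finset.mem_filter] at hp hp'
    obtain ⟨q, ⟨hq, hlt⟩, rfl⟩ := hp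
    obtain ⟨q', ⟨hq', hlt'⟩, rfl⟩ := hp'
    have hqq : q = q' := by
      refine hA.eq_of_anLe hq hq' ?_
      unfold AnLe at *
      simp only at hle
      omega
    exact hne (by rw [hqq])

theorem countBelow_fst_eq_snd_iff (hA : IsAntichainAn n A) (x : ℕ) :
    countBelow A Prod.fst x = countBelow A Prod.snd x ↔ ∀ p ∈ A, p.1 < x → p.2 < x := by
  have hsub : A.filter (fun p => p.2 < x) ⊆ A.filter (fun p => p.1 < x) := by
    intro p
    simp only [Finset.mem_filter]
    exact fun hp => ⟨hp.1, (hA.1 p hp.1).2.1.trans_lt hp.2⟩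
  constructor
  · intro h p hp hpx
    have heq := Finset.eq_of_subset_of_card_le hsub h.le
    have hmem : p ∈ A.filter (fun p => p.2 < x) := by
      rw [heq, Finset.mem_filter]; exact ⟨hp, hpx⟩
    exact (Finset.mem_filter.1 hmem).2
  · intro h
    refine congrArg Finset.card (Finset.Subset.antisymm ?_ hsub)
    intro p
    simp only [Finset.mem_filter]
    exact fun hp => ⟨hp.1, h p hp.1 hp.2⟩

theorem countBelow_fst_eq_snd_of_diag_mem (hA : IsAntichainAn n A) {k : ℕ} (hk : (k, k) ∈ A) :
    countBelow A Prod.fst k = countBelow A Prod.snd k := by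
  rw [hA.countBelow_fst_eq_snd_iff]
  intro p hp hpk
  by_contra hcon
  have := hA.eq_of_anLe hk hp ⟨hpk.le, not_lt.1 hcon⟩
  simp [← this] at hpk

theorem diag_mem_LK_iff (hA : IsAntichainAn n A) {i : ℕ} (hi : 1 ≤ i) (hin : i ≤ n) :
    (i, i) ∈ LK n A ↔ ∀ p ∈ A, ¬ (p.1 ≤ i ∧ i ≤ p.2) := by
  rw [hA.mem_LK_iff hi hin hi hin, Nat.add_left_cancel_iff, hA.countBelow_fst_eq_snd_iff]
  simp only [Finset.mem_image, not_exists, not_and]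
  constructor
  · rintro ⟨h1, h2, h3⟩ p hp hpi
    have := h2 p hp
    have := h3 p hp
    omega
  · intro h
    refine ⟨fun p hp => ?_, fun p hp => ?_, fun p hp => ?_⟩ <;>
    · have := h p hp
      have := (hA.1 p hp).2.1
      omega

theorem countBelow_fst_eq_shorten (hA : IsAntichainAn n A) (x : ℕ) :
    countBelow A Prod.fst x = countBelow (shorten A) Prod.fst x
      + countBelow (A.filter (fun p => p.1 = p.2)) Prod.fst x := by
  unfold countBelow shorten
  rw [Finset.filter_image, Finset.card_image_of_injOn, ← Finset.card_union_of_disjoint]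
  · congr 1
    ext p
    have := hA.1 p
    unfold AnMem at this
    simp only [Finset.mem_filter, Finset.mem_union]
    grind
  · rw [Finset.disjoint_left]; intro p; simp only [Finset.mem_filter]; omega
  · intro p hp q hq h
    simp only [Finset.mem_coe, Finset.mem_filter, Prod.mk.injEq] at hp hq h
    exact hA.injOn_fst hp.1.1 hq.1.1 h.1

theorem countBelow_snd_eq_shorten (hA : IsAntichainAn n A) (x : ℕ) :
    countBelow A Prod.snd (x + 1) = countBelow (shorten A) Prod.snd x
      + countBelow (A.filter (fun p => p.1 = p.2)) Prod.fst (x + 1) := by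
  unfold countBelow shorten
  rw [Finset.filter_image, Finset.card_image_of_injOn, ← Finset.card_union_of_disjoint]
  · congr 1
    ext p
    have := hA.1 p
    unfold AnMem at this
    simp only [Finset.mem_filter, Finset.mem_union]
    grind
  · rw [Finset.disjoint_left]; intro p; simp only [Finset.mem_filter]; omega
  · intro p hp q hq h
    simp only [Finset.mem_coe, Finset.mem_filter, Prod.mk.injEq] at hp hq h
    exact hA.injOn_fst hp.1.1 hq.1.1 h.1

theorem diag_notMem_of_mem_LK (hA : IsAntichainAn n A) {i j k : ℕ} (hi : 1 ≤ i) (hij : i < j)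
    (hj : j ≤ n) (h : (i, j) ∈ LK n A) (hik : i ≤ k) (hkj : k ≤ j) : (k, k) ∉ A := by
  intro hk
  rw [hA.mem_LK_iff hi (by omega) (by omega) hj] at h
  obtain ⟨hiJ, hjI, heq⟩ := h
  have hki : k ≠ i := by rintro rfl; exact hiJ (Finset.mem_image.2 ⟨_, hk, rfl⟩)
  have hkj' : k ≠ j := by rintro rfl; exact hjI (Finset.mem_image.2 ⟨_, hk, rfl⟩)
  have h1 := countBelow_add_le hA.injOn_fst hkj
  have h2 := countBelow_add_le hA.injOn_snd (x := i + 1) (y := k) (by omega)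
  have h3 := countBelow_succ hA.injOn_snd i
  rw [if_neg hiJ] at h3
  have h4 := hA.countBelow_fst_eq_snd_of_diag_mem hk
  omega

theorem diag_notMem_of_countBelow_shorten_le (hA : IsAntichainAn n A) {i j k : ℕ} (hi : 1 ≤ i)
    (hij : i < j)
    (h : j + countBelow (shorten A) Prod.snd i ≤ i + countBelow (shorten A) Prod.fst j)
    (hik : i ≤ k) (hkj : k ≤ j) : (k, k) ∉ A := by
  intro hk
  have hdiag := hA.countBelow_fst_eq_snd_of_diag_mem hk
  have h1 := hA.countBelow_fst_eq_shorten k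
  have h2 := hA.countBelow_snd_eq_shorten (k - 1)
  rw [Nat.sub_add_cancel (by omega)] at h2
  rcases hkj.eq_or_lt with rfl | hkj
  · have h3 := countBelow_add_le hA.shorten.injOn_snd (x := i) (y := k - 1) (by omega)
    omega
  · have hkD : k ∉ (shorten A).image Prod.fst := by
      simp only [shorten, Finset.mem_image, Finset.mem_filter]
      rintro ⟨_, ⟨q, ⟨hq, hlt⟩, rfl⟩, hqk⟩
      have := hA.injOn_fst hq hk hqk
      simp [this] at hlt
    have h3 := countBelow_succ hA.shorten.injOn_fst k
    rw [if_neg hkD] at h3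
    have h4 := countBelow_add_le hA.shorten.injOn_fst (x := k + 1) (y := j) (by omega)
    rcases hik.eq_or_lt with rfl | hik
    · have h5 := countBelow_mono (shorten A) Prod.snd (Nat.sub_le i 1)
      omega
    · have h5 := countBelow_add_le hA.shorten.injOn_snd (x := i) (y := k - 1) (by omega)
      omega

theorem countBelow_diag_succ (hA : IsAntichainAn n A) {k : ℕ} (hk : (k, k) ∉ A) :
    countBelow (A.filter (fun p => p.1 = p.2)) Prod.fst (k + 1)
      = countBelow (A.filter (fun p => p.1 = p.2)) Prod.fst k := by
  rw [countBelow_succ (hA.injOn_fst.mono (Finset.coe_subset.2 (Finset.filter_subset _ _))), if_neg, add_zero]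
  simp only [Finset.mem_image, Finset.mem_filter]
  rintro ⟨⟨a, b⟩, ⟨hp, h1⟩, h2⟩
  simp only at h1 h2
  subst h1 h2
  exact hk hp

theorem mem_LK_iff_mem_of_rowA_eq {B : Finset (ℕ × ℕ)} (hA : IsAntichainAn n A)
    (hB : IsAntichainAn (n - 1) B) (hrow : rowA (n - 1) B = LK (n - 1) (shorten A)) {i j : ℕ}
    (hi : 1 ≤ i) (hij : i < j) (hj : j ≤ n) : (i, j) ∈ LK n A ↔ (i, j - 1) ∈ B := by
  have hmem := hB.mem_iff_of_rowA_eq_LK hA.shorten hrow (x := i) (y := j - 1) hi (by omega)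
    (by omega)
  rw [show j - 1 + 1 = j by omega, show j - 1 + 2 = j + 1 by omega] at hmem
  by_cases hdiag : ∀ k, i ≤ k → k ≤ j → (k, k) ∉ A
  · have hM : ∀ k, i ≤ k → k ≤ j + 1 →
        countBelow (A.filter (fun p => p.1 = p.2)) Prod.fst k
          = countBelow (A.filter (fun p => p.1 = p.2)) Prod.fst i := by
      intro k hik
      induction k, hik using Nat.le_induction with
      | base => exact fun _ => rfl
      | succ k hik ih =>
        intro hkj
        rw [hA.countBelow_diag_succ (hdiag k hik (by omega)), ih (by omega)]
    have hM1 := hM (i + 1) (by omega) (by omega)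
    have hM2 := hM j (by omega) (by omega)
    have hM3 := hM (j + 1) (by omega) (by omega)
    have hG1 := hA.countBelow_snd_eq_shorten i
    have hG2 := hA.countBelow_snd_eq_shorten (i - 1)
    rw [Nat.sub_add_cancel hi] at hG2
    have hF1 := hA.countBelow_fst_eq_shorten j
    have hF2 := hA.countBelow_fst_eq_shorten (j + 1)
    have hG := countBelow_succ hA.injOn_snd i
    have hF := countBelow_succ hA.injOn_fst j
    have hFj := hA.card_compl_fst (a := j) (by omega) (by omega)
    have hi1 : i ∈ A.image Prod.snd → 1 < i := by
      intro h
      obtain ⟨⟨a, b⟩, hp, rfl⟩ := Finset.mem_image.1 h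
      have := hA.1 _ hp
      unfold AnMem at this
      by_contra hcon
      simp only at this hcon
      obtain rfl : a = b := by omega
      exact hdiag a le_rfl hij.le hp
    have hjn : j ∈ A.image Prod.fst → j < n := by
      intro h
      obtain ⟨⟨a, b⟩, hp, rfl⟩ := Finset.mem_image.1 h
      have := hA.1 _ hp
      unfold AnMem at this
      by_contra hcon
      simp only at this hcon
      obtain rfl : a = b := by omega
      exact hdiag a hij.le le_rfl hp
    rw [hmem, hA.mem_LK_iff hi (by omega) (by omega) hj]
    by_cases hiJ : i ∈ A.image Prod.snd <;> by_cases hjI : j ∈ A.image Prod.fst <;>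
      simp only [hiJ, hjI, if_true, if_false, not_true_eq_false, not_false_eq_true, true_and,
        false_and, false_iff, true_implies] at hG hF hi1 hjn ⊢ <;> omega
  · push Not at hdiag
    obtain ⟨k, hik, hkj, hk⟩ := hdiag
    exact iff_of_false (fun h => hA.diag_notMem_of_mem_LK hi hij hj h hik hkj hk)
      (fun h => hA.diag_notMem_of_countBelow_shorten_le hi hij (hmem.1 h).1 hik hkj hk)

end IsAntichainAn

/-- recursive description of the Lalanne–Kreweras involution.
Let `n ≥ 2` and let `A` be an antichain of `Aⁿ`.
(i) For a minimal element `[i,i]`: `[i,i] ∈ LK A` iff `A` contains no `[k,ℓ]` with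
`k ≤ i ≤ ℓ`.
(ii) For a non-minimal element `[i,j]` (`i < j`): `[i,j] ∈ LK A` iff
`[i,j-1] ∈ (Row_A)⁻¹ (LK Ā)`, where `Ā = {[a,b-1] : [a,b] ∈ A, a < b}` is an antichain
of `A^(n-1)` and `LK`, `Row_A` are taken in `A^(n-1)`; the inverse rowmotion is
expressed by quantifying over the (unique) antichain `B` of `A^(n-1)` with
`Row_A B = LK Ā`. -/
theorem stmt7 (n : ℕ) (hn : 2 ≤ n) (A : Finset (ℕ × ℕ)) (hA : IsAntichainAn n A) :
    (∀ i, 1 ≤ i → i ≤ n →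
      ((i, i) ∈ LK n A ↔ ∀ p ∈ A, ¬ (p.1 ≤ i ∧ i ≤ p.2))) ∧
    (∀ i j, 1 ≤ i → i < j → j ≤ n →
      ∀ B : Finset (ℕ × ℕ), IsAntichainAn (n - 1) B →
        rowA (n - 1) B
          = LK (n - 1) ((A.filter (fun p => p.1 < p.2)).image (fun p => (p.1, p.2 - 1))) →
        ((i, j) ∈ LK n A ↔ (i, j - 1) ∈ B)) := by
  exact ⟨fun _ hi hin => hA.diag_mem_LK_iff hi hin, fun _ _ hi hij hj _ hB hrow =>
    hA.mem_LK_iff_mem_of_rowA_eq hB hrow hi hij hj⟩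
end

section
/- For every n ≥ 1 and every antichain A of A^n, LK(A) = Rvac_A(A); that is, the Lalanne–Kreweras involution equals antichain rowvacuation of the graded poset A^n. -/
instance (p q : ℕ × ℕ) : Decidable (AnLe p q ∨ AnLe q p) := inferInstance

/-- The antichain rank toggle `𝛕_i` of `Aⁿ`, in simultaneous form (it agrees with the
composition of the pairwise commuting antichain toggles `τ_p` over the elements `p` of
rank `i`, since distinct elements of equal rank are incomparable in `Aⁿ`): an element `p`
of rank `i` belongs to the image iff `p ∉ A` and `A ∪ {p}` is an antichain, while
membership of elements of other ranks is unchanged. -/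
def atoggleRankAn (n i : ℕ) (A : Finset (ℕ × ℕ)) : Finset (ℕ × ℕ) :=
  (AnUniv n).filter (fun p =>
    if p.2 - p.1 = i then p ∉ A ∧ ∀ q ∈ A, ¬ (AnLe p q ∨ AnLe q p)
    else p ∈ A)

/-- Apply a word of antichain rank toggles; the head of the list is applied last. -/
def applyRankTogglesAn (n : ℕ) : List ℕ → Finset (ℕ × ℕ) → Finset (ℕ × ℕ)
  | [], A => A
  | i :: w, A => atoggleRankAn n i (applyRankTogglesAn n w A)

/-- The word `(𝛕_r)(𝛕_r 𝛕_{r-1}) ⋯ (𝛕_r 𝛕_{r-1} ⋯ 𝛕_1 𝛕_0)` for antichain rowvacuation. -/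
def arvacWordC (r : ℕ) : List ℕ :=
  (List.range (r + 1)).foldr
    (fun k acc => (List.range (r + 1)).reverse.take (k + 1) ++ acc) []

/-- Antichain rowvacuation `Rvac_A` of the graded poset `Aⁿ` (of rank `n - 1`). -/
def rvacAn (n : ℕ) : Finset (ℕ × ℕ) → Finset (ℕ × ℕ) :=
  applyRankTogglesAn n (arvacWordC (n - 1))

theorem mem_atoggleRankAn {n i : ℕ} {A : Finset (ℕ × ℕ)} {p : ℕ × ℕ} :
    p ∈ atoggleRankAn n i A ↔ AnMem n p ∧
      if p.2 - p.1 = i then p ∉ A ∧ ∀ q ∈ A, ¬ (AnLe p q ∨ AnLe q p) else p ∈ A := by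
  simp only [atoggleRankAn, Finset.mem_filter, mem_AnUniv]

theorem applyRankTogglesAn_append (n : ℕ) (v w : List ℕ) (A : Finset (ℕ × ℕ)) :
    applyRankTogglesAn n (v ++ w) A = applyRankTogglesAn n v (applyRankTogglesAn n w A) := by
  induction v with
  | nil => rfl
  | cons i v ih => simp only [List.cons_append, applyRankTogglesAn, ih]

/-- `p` is minimal among the elements of rank at least `k` which lie neither below an element of
`C` nor above an element of `C` of rank less than `k`. -/
def IsMinOutside (n k : ℕ) (C : Finset (ℕ × ℕ)) (p : ℕ × ℕ) : Prop :=
  AnMem n p ∧ k ≤ p.2 - p.1 ∧ (∀ q ∈ C, ¬ AnLe p q) ∧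
    (∀ q ∈ C, q.2 - q.1 < k → ¬ AnLe q p) ∧
    (p.2 - p.1 = k ∨ (∃ q ∈ C, AnLe (p.1 + 1, p.2) q) ∧ ∃ q ∈ C, AnLe (p.1, p.2 - 1) q)

theorem exists_isMinOutside_le {n k : ℕ} {C : Finset (ℕ × ℕ)} {p : ℕ × ℕ} (hp : AnMem n p)
    (hk : k ≤ p.2 - p.1) (hC : ∀ q ∈ C, ¬ AnLe p q)
    (hT : ∀ q ∈ C, q.2 - q.1 < k → ¬ AnLe q p) : ∃ q, IsMinOutside n k C q ∧ AnLe q p := by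
  induction hd : p.2 - p.1 using Nat.strong_induction_on generalizing p with
  | _ d ih =>
    obtain ⟨a, b⟩ := p
    simp only [AnMem, AnLe] at *
    by_cases hkd : b - a = k
    · exact ⟨(a, b), ⟨hp, hk, hC, hT, Or.inl hkd⟩, le_rfl, le_rfl⟩
    by_cases h1 : ∃ q ∈ C, AnLe (a + 1, b) q
    · by_cases h2 : ∃ q ∈ C, AnLe (a, b - 1) q
      · exact ⟨(a, b), ⟨hp, hk, hC, hT, Or.inr ⟨h1, h2⟩⟩, le_rfl, le_rfl⟩
      · obtain ⟨q, hq, hle⟩ := ih (b - 1 - a) (by omega) (p := (a, b - 1)) (by simp; omega)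
          (by simp; omega) (fun q hq h => h2 ⟨q, hq, h⟩)
          (fun q hq hqk h => hT q hq hqk ⟨h.1, by have := h.2; simp at this; omega⟩) rfl
        exact ⟨q, hq, hle.1, by have := hle.2; simp at this; omega⟩
    · obtain ⟨q, hq, hle⟩ := ih (b - (a + 1)) (by omega) (p := (a + 1, b)) (by simp; omega)
          (by simp; omega) (fun q hq h => h1 ⟨q, hq, h⟩)
          (fun q hq hqk h => hT q hq hqk ⟨by have := h.1; simp at this; omega, h.2⟩) rfl
      exact ⟨q, hq, by have := hle.1; simp at this; omega, hle.2⟩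

/-- An element of rank `m ≥ k` is switched on by the `m`-th toggle of a pass starting at rank `k`
exactly when it is minimal outside. -/
theorem toggle_iff_isMinOutside {n k m : ℕ} {C D : Finset (ℕ × ℕ)} (hC : IsAntichainAn n C)
    (hkm : k ≤ m)
    (hD : ∀ p, p ∈ D ↔ AnMem n p ∧
      if k ≤ p.2 - p.1 ∧ p.2 - p.1 < m then IsMinOutside n k C p else p ∈ C)
    {p : ℕ × ℕ} (hp : AnMem n p) (hpm : p.2 - p.1 = m) :
    (p ∉ D ∧ ∀ q ∈ D, ¬ (AnLe p q ∨ AnLe q p)) ↔ IsMinOutside n k C p := by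
  constructor
  · rintro ⟨-, h⟩
    have hpC : ∀ q ∈ C, ¬ AnLe p q := by
      intro q hq hpq
      have hqm := hC.1 q hq
      refine h q ((hD q).2 ⟨hqm, ?_⟩) (Or.inl hpq)
      rw [if_neg]
      · exact hq
      · simp only [AnLe, AnMem] at *; omega
    have hpT : ∀ q ∈ C, q.2 - q.1 < k → ¬ AnLe q p := by
      intro q hq hqk hqp
      refine h q ((hD q).2 ⟨hC.1 q hq, ?_⟩) (Or.inr hqp)
      rw [if_neg]
      · exact hq
      · omega
    have key : ∀ r : ℕ × ℕ, AnMem n r → k ≤ r.2 - r.1 → r.2 - r.1 < m → AnLe r p →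
        ∃ q ∈ C, AnLe r q := by
      intro r hr hkr hrm hrp
      by_contra! hno
      obtain ⟨q, hq, hqr⟩ := exists_isMinOutside_le hr hkr hno
        (fun q hq hqk hqr => hpT q hq hqk ⟨hrp.1.trans hqr.1, hqr.2.trans hrp.2⟩)
      refine h q ((hD q).2 ⟨hq.1, ?_⟩) (Or.inr ⟨hrp.1.trans hqr.1, hqr.2.trans hrp.2⟩)
      rw [if_pos]
      · exact hq
      · have := hq.2.1
        have := hq.1
        simp only [AnLe, AnMem] at *; omega
    refine ⟨hp, hpm ▸ hkm, hpC, hpT, ?_⟩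
    by_cases hmk : m = k
    · exact Or.inl (hpm.trans hmk)
    · right
      simp only [AnMem] at hp
      constructor <;> apply key <;> simp only [AnMem, AnLe] <;> omega
  · intro hM
    have hpC : p ∉ C := fun h => hM.2.2.1 p h ⟨le_rfl, le_rfl⟩
    refine ⟨fun h => hpC ?_, ?_⟩
    · have := ((hD p).1 h).2
      rwa [if_neg (by omega)] at this
    · intro q hq hcomp
      obtain ⟨hqm, hq⟩ := (hD q).1 hq
      split_ifs at hq with hr
      · rcases hcomp with hpq | hqp
        · simp only [AnLe, AnMem] at *; omega
        · rcases hM.2.2.2.2 with h | ⟨⟨s, hs, hsl⟩, t, ht, htl⟩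
          · omega
          · have h1 := hq.2.2.1 s hs
            have h2 := hq.2.2.1 t ht
            simp only [AnLe, AnMem] at *; omega
      · rcases hcomp with hpq | hqp
        · exact hM.2.2.1 q hq hpq
        · by_cases hqk : q.2 - q.1 < k
          · exact hM.2.2.2.1 q hq hqk hqp
          · have : q = p := by
              simp only [AnLe, AnMem] at *
              ext <;> omega
            exact hpC (this ▸ hq)

/-- The effect of the toggles at the ranks `k, k + 1, …, k + d - 1`, in this order. -/
theorem mem_applyRankTogglesAn_range' {n k : ℕ} {C : Finset (ℕ × ℕ)} (hC : IsAntichainAn n C)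
    (d : ℕ) (p : ℕ × ℕ) :
    p ∈ applyRankTogglesAn n (List.range' k d).reverse C ↔ AnMem n p ∧
      if k ≤ p.2 - p.1 ∧ p.2 - p.1 < k + d then IsMinOutside n k C p else p ∈ C := by
  induction d generalizing p with
  | zero =>
    rw [if_neg (by omega)]
    exact ⟨fun h => ⟨hC.1 p h, h⟩, fun h => h.2⟩
  | succ d ih =>
    rw [List.range'_concat, List.reverse_append, one_mul]
    simp only [List.reverse_singleton, List.singleton_append, applyRankTogglesAn,
      mem_atoggleRankAn]
    refine and_congr_right fun hp => ?_
    by_cases hpm : p.2 - p.1 = k + d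
    · rw [if_pos hpm, if_pos (by omega)]
      exact toggle_iff_isMinOutside hC (by omega) ih hp hpm
    · rw [if_neg hpm, ih]
      simp only [hp, true_and]
      have : (k ≤ p.2 - p.1 ∧ p.2 - p.1 < k + d) ↔
          (k ≤ p.2 - p.1 ∧ p.2 - p.1 < k + (d + 1)) := by omega
      simp only [this]

/-- `D` arises from `C` by toggling all ranks `≥ k` in increasing order. -/
def IsPass (n k : ℕ) (C D : Finset (ℕ × ℕ)) : Prop :=
  ∀ p, p ∈ D ↔ (p.2 - p.1 < k ∧ p ∈ C) ∨ IsMinOutside n k C p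

theorem isPass_applyRankTogglesAn {n k : ℕ} {C : Finset (ℕ × ℕ)} (hC : IsAntichainAn n C)
    (hk : k ≤ n) : IsPass n k C (applyRankTogglesAn n (List.range' k (n - k)).reverse C) := by
  intro p
  rw [mem_applyRankTogglesAn_range' hC]
  by_cases hpk : p.2 - p.1 < k
  · rw [if_neg (by omega)]
    exact ⟨fun h => Or.inl ⟨hpk, h.2⟩, fun h => h.elim (fun h => ⟨hC.1 p h.2, h.2⟩)
      (fun h => absurd h.2.1 (by omega))⟩
  · constructor
    · rintro ⟨hp, h⟩
      rw [if_pos (by simp only [AnMem] at hp; omega)] at h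
      exact Or.inr h
    · rintro (h | h)
      · exact absurd h.1 hpk
      · refine ⟨h.1, ?_⟩
        rw [if_pos]
        · exact h
        · have := h.1
          simp only [AnMem] at this; omega

/-- `[i, i + k]` is an interval of `[n]` containing no member of `C` of rank less than `k`. -/
def IsFree (n k : ℕ) (C : Finset (ℕ × ℕ)) (i : ℕ) : Prop :=
  1 ≤ i ∧ i + k ≤ n ∧ ∀ q ∈ C, q.2 - q.1 < k → ¬ AnLe q (i, i + k)

/-- `[i, i + k]` is below a member of `C`. -/
def IsCovered (k : ℕ) (C : Finset (ℕ × ℕ)) (i : ℕ) : Prop :=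
  ∃ q ∈ C, AnLe (i, i + k) q

theorem IsPass.isAntichainAn {n k : ℕ} {C D : Finset (ℕ × ℕ)} (hC : IsAntichainAn n C)
    (h : IsPass n k C D) : IsAntichainAn n D := by
  constructor
  · intro p hp
    rcases (h p).1 hp with h | h
    · exact hC.1 p h.2
    · exact h.1
  · intro p hp q hq hne hle
    rcases (h p).1 hp with hp | hp <;> rcases (h q).1 hq with hq | hq
    · exact hC.2 p hp.2 q hq.2 hne hle
    · exact hq.2.2.2.1 p hp.2 hp.1 hle
    · exact hp.2.2.1 q hq.2 hle
    · obtain ⟨a, b⟩ := p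
      obtain ⟨c, d⟩ := q
      rcases hq.2.2.2.2 with h | ⟨⟨s, hs, hsl⟩, t, ht, htl⟩
      · have h1 := hp.2.1
        have h2 := hp.1
        have h3 := hq.1
        simp only [AnLe, AnMem] at *
        exact hne (by ext <;> simp only <;> omega)
      · have h1 := hp.2.2.1 s hs
        have h2 := hp.2.2.1 t ht
        simp only [AnLe, ne_eq, Prod.mk.injEq] at *
        omega

theorem IsCovered.isFree {n k : ℕ} {C : Finset (ℕ × ℕ)} (hC : IsAntichainAn n C) {i : ℕ}
    (h : IsCovered k C i) : IsFree n k C i := by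
  obtain ⟨c, hc, hle⟩ := h
  have hcm := hC.1 c hc
  refine ⟨by simp only [AnLe, AnMem] at *; omega, by simp only [AnLe, AnMem] at *; omega, ?_⟩
  intro q hq hqk hqi
  refine hC.2 q hq c hc ?_ ⟨hle.1.trans hqi.1, hqi.2.trans hle.2⟩
  rintro rfl
  simp only [AnLe] at *; omega

theorem isMinOutside_rank_iff {n k : ℕ} {C : Finset (ℕ × ℕ)} {i : ℕ} :
    IsMinOutside n k C (i, i + k) ↔ IsFree n k C i ∧ ¬ IsCovered k C i := by
  constructor
  · intro h
    have h1 := h.1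
    simp only [AnMem] at h1
    exact ⟨⟨h1.1, h1.2.2, h.2.2.2.1⟩, fun ⟨q, hq, hle⟩ => h.2.2.1 q hq hle⟩
  · rintro ⟨⟨h1, h2, h3⟩, h4⟩
    exact ⟨⟨h1, by simp, h2⟩, by simp, fun q hq hle => h4 ⟨q, hq, hle⟩, h3, Or.inl (by simp)⟩

theorem IsPass.isFree_succ_iff {n k : ℕ} {C D : Finset (ℕ × ℕ)} (hC : IsAntichainAn n C)
    (h : IsPass n k C D) {i : ℕ} :
    IsFree n (k + 1) D i ↔ IsCovered k C i ∧ IsCovered k C (i + 1) := by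
  constructor
  · rintro ⟨h1, h2, h3⟩
    have key : ∀ x, i ≤ x → x ≤ i + 1 → IsCovered k C x := by
      intro x hx hx'
      by_contra hno
      refine h3 (x, x + k) ((h _).2 (Or.inr (isMinOutside_rank_iff.2 ⟨⟨by omega, by omega, ?_⟩,
        hno⟩))) (by simp) ⟨hx, by simp only; omega⟩
      intro q hq hqk hle
      refine h3 q ((h q).2 (Or.inl ⟨hqk, hq⟩)) (by omega) ?_
      simp only [AnLe] at *; omega
    exact ⟨key i le_rfl (by omega), key (i + 1) (by omega) le_rfl⟩
  · rintro ⟨h1, h2⟩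
    have f1 := h1.isFree hC
    have f2 := h2.isFree hC
    refine ⟨f1.1, by have := f2.2.1; omega, ?_⟩
    intro q hq hqk hle
    have hcases : AnLe q (i, i + k) ∨ AnLe q (i + 1, i + 1 + k) := by
      simp only [AnLe] at *; omega
    rcases (h q).1 hq with hq | hq
    · exact hcases.elim (f1.2.2 q hq.2 hq.1) (f2.2.2 q hq.2 hq.1)
    · rcases hcases with hle' | hle'
      · obtain ⟨c, hc, hcl⟩ := h1
        exact hq.2.2.1 c hc ⟨hcl.1.trans hle'.1, hle'.2.trans hcl.2⟩
      · obtain ⟨c, hc, hcl⟩ := h2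
        exact hq.2.2.1 c hc ⟨hcl.1.trans hle'.1, hle'.2.trans hcl.2⟩

/-- Two members of `C` overlapping in a suitable way, with no right endpoint strictly between
theirs, produce a new minimal element. -/
theorem IsAntichainAn.isMinOutside_of_consecutive {n k : ℕ} {C : Finset (ℕ × ℕ)}
    (hC : IsAntichainAn n C) {a b c d : ℕ} (hab : (a, b) ∈ C) (hcd : (c, d) ∈ C) (hac : a < c)
    (hk : k + c ≤ b + 1) (hmin : ∀ q ∈ C, b < q.2 → c ≤ q.1) :
    IsMinOutside n k C (c - 1, b + 1) := by
  have h1 := hC.1 _ hab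
  have h2 := hC.1 _ hcd
  have hbd : b < d := by
    by_contra hbd
    exact hC.2 _ hcd _ hab (by simp only [ne_eq, Prod.mk.injEq]; omega)
      ⟨hac.le, by simp only; omega⟩
  simp only [AnMem] at h1 h2
  refine ⟨by simp only [AnMem]; omega, by simp only; omega, ?_, ?_,
    Or.inr ⟨⟨_, hcd, by simp only [AnLe]; omega⟩, ⟨_, hab, by simp only [AnLe]; omega⟩⟩⟩
  · intro q hq hle
    have := hmin q hq (by simp only [AnLe] at hle; omega)
    simp only [AnLe] at hle; omega
  · intro q hq hqk hle
    have hqm := hC.1 q hq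
    have hcases : AnLe q (a, b) ∨ AnLe q (c, d) := by
      simp only [AnLe, AnMem] at *; omega
    rcases hcases with h | h
    · refine hC.2 q hq _ hab ?_ h
      rintro rfl
      simp only [AnLe] at *; omega
    · refine hC.2 q hq _ hcd ?_ h
      rintro rfl
      simp only [AnLe] at *; omega

theorem IsPass.isCovered_and_snd_iff {n k : ℕ} {C D : Finset (ℕ × ℕ)} (hC : IsAntichainAn n C)
    (h : IsPass n k C D) (i : ℕ) :
    (IsCovered k C i ∧ ∀ q ∈ C, k ≤ q.2 - q.1 → q.2 ≠ i + k) ↔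
      IsFree n (k + 1) D i ∧ ∀ q ∈ D, k + 1 ≤ q.2 - q.1 → q.2 ≠ i + (k + 1) := by
  rw [h.isFree_succ_iff hC]
  constructor
  · rintro ⟨⟨p, hp, hpi⟩, hno⟩
    have hp2 := hno p hp (by simp only [AnLe] at hpi; omega)
    refine ⟨⟨⟨p, hp, hpi⟩, p, hp, by simp only [AnLe] at *; omega⟩, ?_⟩
    intro q hq hqk hqi
    rcases (h q).1 hq with hq | hq
    · omega
    rcases hq.2.2.2.2 with h | ⟨-, c, hc, hle⟩
    · omega
    · have h1 := hno c hc (by simp only [AnLe] at *; omega)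
      have h2 := hq.2.2.1 c hc
      simp only [AnLe] at *; omega
  · rintro ⟨⟨h1, ⟨p, hp, hpi⟩⟩, hno⟩
    refine ⟨h1, ?_⟩
    rintro ⟨a, b⟩ hab habk hb
    simp only at hb habk
    obtain ⟨⟨c, d⟩, hcd, hmin⟩ := (C.filter (fun q => b < q.2)).exists_min_image Prod.fst
      ⟨p, by simp only [Finset.mem_filter]; exact ⟨hp, by simp only [AnLe] at hpi; omega⟩⟩
    simp only [Finset.mem_filter] at hcd hmin
    have hcp := hmin p ⟨hp, by simp only [AnLe] at hpi; omega⟩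
    have hac : a < c := by
      by_contra hac
      exact hC.2 _ hab _ hcd.1 (by simp only [ne_eq, Prod.mk.injEq]; omega)
        (by simp only [AnLe]; omega)
    have := hC.isMinOutside_of_consecutive (k := k) hab hcd.1 hac
      (by simp only [AnLe] at hpi; omega) (fun q hq hbq => hmin q ⟨hq, hbq⟩)
    exact hno _ ((h _).2 (Or.inr this)) (by simp only [AnLe] at *; omega)
      (by simp only; omega)

theorem IsPass.isCovered_and_fst_iff {n k : ℕ} {C D : Finset (ℕ × ℕ)} (hC : IsAntichainAn n C)
    (h : IsPass n k C D) (i : ℕ) :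
    (IsCovered k C (i + 1) ∧ ∀ q ∈ C, k ≤ q.2 - q.1 → q.1 ≠ i + 1) ↔
      IsFree n (k + 1) D i ∧ ∀ q ∈ D, k + 1 ≤ q.2 - q.1 → q.1 ≠ i := by
  rw [h.isFree_succ_iff hC]
  constructor
  · rintro ⟨⟨p, hp, hpi⟩, hno⟩
    have hp2 := hno p hp (by simp only [AnLe] at hpi; omega)
    refine ⟨⟨⟨p, hp, by simp only [AnLe] at *; omega⟩, p, hp, hpi⟩, ?_⟩
    intro q hq hqk hqi
    rcases (h q).1 hq with hq | hq
    · omega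
    rcases hq.2.2.2.2 with h | ⟨⟨c, hc, hle⟩, -⟩
    · omega
    · have h1 := hno c hc (by simp only [AnLe] at *; omega)
      have h2 := hq.2.2.1 c hc
      simp only [AnLe] at *; omega
  · rintro ⟨⟨⟨p, hp, hpi⟩, h2⟩, hno⟩
    refine ⟨h2, ?_⟩
    rintro ⟨c, d⟩ hcd hcdk hc
    simp only at hc hcdk
    obtain ⟨⟨a, b⟩, hab, hmax⟩ := (C.filter (fun q => q.1 < c)).exists_max_image Prod.snd
      ⟨p, by simp only [Finset.mem_filter]; exact ⟨hp, by simp only [AnLe] at hpi; omega⟩⟩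
    simp only [Finset.mem_filter] at hab hmax
    have hbp := hmax p ⟨hp, by simp only [AnLe] at hpi; omega⟩
    have := hC.isMinOutside_of_consecutive (k := k) hab.1 hcd hab.2
      (by simp only [AnLe] at hpi; omega) (fun q hq hbq => by
        by_contra hqc
        have := hmax q ⟨hq, by omega⟩
        omega)
    exact hno _ ((h _).2 (Or.inr this)) (by simp only [AnLe] at *; omega)
      (by simp only; omega)

/-- The set of left endpoints of the Lalanne–Kreweras image, read off from the state `C` reached
after toggling through the passes starting at the ranks `0, …, k - 1`. -/
def LKFst (n k : ℕ) (C : Finset (ℕ × ℕ)) (i : ℕ) : Prop :=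
  (∃ p ∈ C, p.2 - p.1 < k ∧ p.1 = i) ∨
    (IsFree n k C i ∧ ∀ q ∈ C, k ≤ q.2 - q.1 → q.2 ≠ i + k)

/-- The set of right endpoints of the Lalanne–Kreweras image, read off from the state `C` reached
after toggling through the passes starting at the ranks `0, …, k - 1`. -/
def LKSnd (n k : ℕ) (C : Finset (ℕ × ℕ)) (j : ℕ) : Prop :=
  (∃ p ∈ C, p.2 - p.1 < k ∧ p.2 = j) ∨
    ∃ i, j = i + k ∧ IsFree n k C i ∧ ∀ q ∈ C, k ≤ q.2 - q.1 → q.1 ≠ i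

/-- Members of rank at most `k` after the pass starting at rank `k`. -/
theorem IsPass.mem_and_lt_succ_iff {n k : ℕ} {C D : Finset (ℕ × ℕ)} (h : IsPass n k C D)
    {p : ℕ × ℕ} : (p ∈ D ∧ p.2 - p.1 < k + 1) ↔ (p ∈ C ∧ p.2 - p.1 < k) ∨
      (p.2 = p.1 + k ∧ IsFree n k C p.1 ∧ ¬ IsCovered k C p.1) := by
  obtain ⟨a, b⟩ := p
  rw [h]
  constructor
  · rintro ⟨h1 | h1, h2⟩
    · exact Or.inl h1.symm
    · have hm := h1.1
      have hk := h1.2.1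
      simp only [AnMem] at hm hk h2
      obtain rfl : b = a + k := by omega
      exact Or.inr ⟨rfl, isMinOutside_rank_iff.1 h1⟩
  · rintro (h1 | ⟨h1, h2⟩)
    · exact ⟨Or.inl h1.symm, by omega⟩
    · simp only at h1 h2
      subst h1
      exact ⟨Or.inr (isMinOutside_rank_iff.2 h2), by simp⟩

theorem IsPass.lkFst_iff {n k : ℕ} {C D : Finset (ℕ × ℕ)} (hC : IsAntichainAn n C)
    (h : IsPass n k C D) (i : ℕ) : LKFst n (k + 1) D i ↔ LKFst n k C i := by
  unfold LKFst
  rw [← h.isCovered_and_snd_iff hC]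
  simp only [← and_assoc, h.mem_and_lt_succ_iff]
  constructor
  · rintro (⟨p, ⟨hp, hpk⟩ | ⟨⟨hp, hf⟩, hc⟩, rfl⟩ | ⟨hc, hno⟩)
    · exact Or.inl ⟨p, ⟨hp, hpk⟩, rfl⟩
    · refine Or.inr ⟨hf, fun q hq hqk hqi => hc ⟨q, hq, ?_⟩⟩
      have := hC.1 q hq
      simp only [AnLe, AnMem] at *; omega
    · exact Or.inr ⟨hc.isFree hC, hno⟩
  · rintro (⟨p, hp, rfl⟩ | ⟨hf, hno⟩)
    · exact Or.inl ⟨p, Or.inl hp, rfl⟩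
    · by_cases hc : IsCovered k C i
      · exact Or.inr ⟨hc, hno⟩
      · exact Or.inl ⟨(i, i + k), Or.inr ⟨⟨rfl, hf⟩, hc⟩, rfl⟩

theorem IsPass.lkSnd_iff {n k : ℕ} {C D : Finset (ℕ × ℕ)} (hC : IsAntichainAn n C)
    (h : IsPass n k C D) (j : ℕ) : LKSnd n (k + 1) D j ↔ LKSnd n k C j := by
  unfold LKSnd
  simp only [← h.isCovered_and_fst_iff hC]
  simp only [← and_assoc, h.mem_and_lt_succ_iff]
  constructor
  · rintro (⟨p, ⟨hp, hpk⟩ | ⟨⟨hp, hf⟩, hc⟩, rfl⟩ | ⟨i, ⟨rfl, hc⟩, hno⟩)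
    · exact Or.inl ⟨p, ⟨hp, hpk⟩, rfl⟩
    · refine Or.inr ⟨p.1, ⟨hp, hf⟩, fun q hq hqk hqi => hc ⟨q, hq, ?_⟩⟩
      have := hC.1 q hq
      simp only [AnLe, AnMem] at *; omega
    · exact Or.inr ⟨i + 1, ⟨by omega, hc.isFree hC⟩, hno⟩
  · rintro (⟨p, hp, rfl⟩ | ⟨i, ⟨rfl, hf⟩, hno⟩)
    · exact Or.inl ⟨p, Or.inl hp, rfl⟩
    · by_cases hc : IsCovered k C i
      · obtain _ | i := i
        · exact absurd hf.1 (by omega)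
        · exact Or.inr ⟨i, ⟨by omega, hc⟩, hno⟩
      · exact Or.inl ⟨(i, i + k), Or.inr ⟨⟨rfl, hf⟩, hc⟩, rfl⟩

/-- The pass of the rowvacuation word starting at rank `d`. -/
theorem arvacWordC_pass {n d : ℕ} (hd : d < n) :
    (List.range (n - 1 + 1)).reverse.take (n - (d + 1) + 1) =
      (List.range' d (n - d)).reverse := by
  rw [List.take_reverse, List.length_range, List.range_eq_range', List.drop_range']
  congr 2 <;> omega

/-- The state of rowvacuation after its first `d` passes. -/
theorem rvac_passes {n : ℕ} {A : Finset (ℕ × ℕ)} (hA : IsAntichainAn n A) {d : ℕ}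
    (hd : d ≤ n) (C : Finset (ℕ × ℕ)) (hC : C = applyRankTogglesAn n
      ((List.range' (n - d) d).foldr
        (fun k acc => (List.range (n - 1 + 1)).reverse.take (k + 1) ++ acc) []) A) :
    IsAntichainAn n C ∧ (∀ i, LKFst n d C i ↔ LKFst n 0 A i) ∧
      ∀ j, LKSnd n d C j ↔ LKSnd n 0 A j := by
  induction d generalizing C with
  | zero =>
    subst hC
    exact ⟨hA, fun _ => Iff.rfl, fun _ => Iff.rfl⟩
  | succ d ih =>
    rw [List.range'_succ, show n - (d + 1) + 1 = n - d by omega, List.foldr_cons,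
      applyRankTogglesAn_append, arvacWordC_pass (by omega)] at hC
    obtain ⟨h1, h2, h3⟩ := ih (by omega) _ rfl
    have hpass := isPass_applyRankTogglesAn h1 (k := d) (by omega)
    rw [← hC] at hpass
    exact ⟨hpass.isAntichainAn h1, fun i => (hpass.lkFst_iff h1 i).trans (h2 i),
      fun j => (hpass.lkSnd_iff h1 j).trans (h3 j)⟩

theorem IsAntichainAn.fst_lt_iff {n : ℕ} {D : Finset (ℕ × ℕ)} (hD : IsAntichainAn n D)
    {p q : ℕ × ℕ} (hp : p ∈ D) (hq : q ∈ D) : p.1 < q.1 ↔ p.2 < q.2 := by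
  by_cases hpq : p = q
  · simp [hpq]
  · have h1 := hD.2 p hp q hq hpq
    have h2 := hD.2 q hq p hp (Ne.symm hpq)
    simp only [AnLe] at h1 h2
    omega

/-- An antichain is recovered from its sets of left and right endpoints. -/
theorem IsAntichainAn.zip_sort {n : ℕ} {D : Finset (ℕ × ℕ)} (hD : IsAntichainAn n D) :
    (List.zip ((D.image Prod.fst).sort (· ≤ ·)) ((D.image Prod.snd).sort (· ≤ ·))).toFinset
      = D := by
  set L := (D.image toLex).sort (· ≤ ·) with hL
  have hmem : ∀ x ∈ L, ofLex x ∈ D := by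
    intro x hx
    rw [hL, Finset.mem_sort, Finset.mem_image] at hx
    obtain ⟨p, hp, rfl⟩ := hx
    exact hp
  have hfst : ∀ x ∈ L, ∀ y ∈ L, x < y → (ofLex x).1 < (ofLex y).1 := by
    intro x hx y hy hxy
    rcases Prod.Lex.lt_iff.1 hxy with h | ⟨h, h'⟩
    · exact h
    · exact absurd ((hD.fst_lt_iff (hmem x hx) (hmem y hy)).2 h') h.not_lt
  have hpair : L.Pairwise (· < ·) := (Finset.sortedLT_sort _).pairwise
  have h1 : L.map (fun x => (ofLex x).1) = (D.image Prod.fst).sort (· ≤ ·) := by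
    refine List.SortedLT.eq_of_mem_iff (List.Pairwise.sortedLT ?_) (Finset.sortedLT_sort _) ?_
    · exact List.pairwise_map.2 (hpair.imp_of_mem fun hx hy h => hfst _ hx _ hy h)
    · simp [hL]
  have h2 : L.map (fun x => (ofLex x).2) = (D.image Prod.snd).sort (· ≤ ·) := by
    refine List.SortedLT.eq_of_mem_iff (List.Pairwise.sortedLT ?_) (Finset.sortedLT_sort _) ?_
    · exact List.pairwise_map.2 (hpair.imp_of_mem fun hx hy h =>
        (hD.fst_lt_iff (hmem _ hx) (hmem _ hy)).1 (hfst _ hx _ hy h))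
    · simp [hL]
  rw [← h1, ← h2, List.zip_map']
  ext ⟨a, b⟩
  simp [hL]

/-- For every `n ≥ 1` and every antichain `A` of `Aⁿ`,
`LK A = Rvac_A A`: the Lalanne–Kreweras involution equals antichain rowvacuation of the
graded poset `Aⁿ`. -/
theorem stmt8 (n : ℕ) (hn : 1 ≤ n) (A : Finset (ℕ × ℕ)) (hA : IsAntichainAn n A) :
    LK n A = rvacAn n A := by
  obtain ⟨h1, h2, h3⟩ := rvac_passes hA le_rfl (rvacAn n A)
    (by rw [Nat.sub_self, ← List.range_eq_range', rvacAn, arvacWordC, Nat.sub_add_cancel hn])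
  have hrank : ∀ p ∈ rvacAn n A, p.2 - p.1 < n := by
    intro p hp
    have := h1.1 p hp
    simp only [AnMem] at this
    omega
  have hfst : Finset.Icc 1 n \ A.image Prod.snd = (rvacAn n A).image Prod.fst := by
    ext i
    have := h2 i
    simp only [LKFst, IsFree] at this
    simp only [Finset.mem_sdiff, Finset.mem_Icc, Finset.mem_image]
    constructor
    · rintro ⟨⟨hi, hi'⟩, hno⟩
      rcases this.2 (Or.inr ⟨⟨hi, by omega, by simp⟩, fun q hq _ h => hno ⟨q, hq, h⟩⟩) with h | h
      · exact h.imp fun p hp => ⟨hp.1, hp.2.2⟩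
      · omega
    · rintro ⟨p, hp, rfl⟩
      rcases this.1 (Or.inl ⟨p, hp, hrank p hp, rfl⟩) with ⟨_, _, h, _⟩ | ⟨h, h'⟩
      · omega
      · exact ⟨⟨h.1, h.2.1⟩, fun ⟨q, hq, hqp⟩ => h' q hq (by omega) hqp⟩
  have hsnd : Finset.Icc 1 n \ A.image Prod.fst = (rvacAn n A).image Prod.snd := by
    ext j
    have := h3 j
    simp only [LKSnd, IsFree] at this
    simp only [Finset.mem_sdiff, Finset.mem_Icc, Finset.mem_image]
    constructor
    · rintro ⟨⟨hi, hi'⟩, hno⟩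
      rcases this.2 (Or.inr ⟨j, rfl, ⟨hi, by omega, by simp⟩,
        fun q hq _ h => hno ⟨q, hq, h⟩⟩) with h | ⟨_, _, h, _⟩
      · exact h.imp fun p hp => ⟨hp.1, hp.2.2⟩
      · omega
    · rintro ⟨p, hp, rfl⟩
      rcases this.1 (Or.inl ⟨p, hp, hrank p hp, rfl⟩) with ⟨_, _, h, _⟩ | ⟨i, hi, h, h'⟩
      · omega
      · exact ⟨⟨by omega, by omega⟩, fun ⟨q, hq, hqp⟩ => h' q hq (by omega) (by omega)⟩
  rw [LK, hfst, hsnd, h1.zip_sort]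
end

section
/- For every n ≥ 1, κ > 0, every π : A^n → R>0, and every 1 ≤ i ≤ n, h^B_i(π) · h^B_i(LK^B(π)) = κ²; that is, each statistic h^B_i is multiplicatively κ-mesic with respect to the action of the birational Lalanne–Kreweras involution LK^B on A^B_κ(A^n). -/
open scoped Classical

noncomputable section

/-- `P̂`: the poset `P` with a new minimum `0̂` and a new maximum `1̂` adjoined. -/
abbrev Phat (P : Type) := WithBot (WithTop P)

instance {P : Type} [Fintype P] : Fintype (Phat P) :=
  inferInstanceAs (Fintype (Option (Option P)))

/-- The inclusion of `P` into `P̂`. -/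
def emb {P : Type} (p : P) : Phat P := ((p : WithTop P) : WithBot (WithTop P))

/-- The new maximum `1̂` of `P̂`. -/
def topHat (P : Type) : Phat P := ((⊤ : WithTop P) : WithBot (WithTop P))

variable {P : Type} [Fintype P] [PartialOrder P]

/-- `∑_{y ⋖ x} π(y)`. -/
def covSumBelow (π : Phat P → ℝ) (x : Phat P) : ℝ :=
  ∑ y : Phat P, if y ⋖ x then π y else 0

/-- `∑_{x ⋖ y} 1/π(y)`. -/
def covSumAboveInv (π : Phat P → ℝ) (x : Phat P) : ℝ :=
  ∑ y : Phat P, if x ⋖ y then (π y)⁻¹ else 0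

/-- The birational order-filter rank toggle `𝐭_i`, in simultaneous form (it agrees with the
composition of the pairwise commuting birational order filter toggles `t_p` over `p ∈ P_i`,
since a toggle `t_p` only changes the value at `p` and only reads values at `p` and at
elements covering or covered by `p`, which have different ranks). -/
def rankToggleB (rk : P → ℕ) (i : ℕ) (π : Phat P → ℝ) : Phat P → ℝ :=
  fun x =>
    if ∃ p : P, rk p = i ∧ x = emb p then
      covSumBelow π x / (π x * covSumAboveInv π x)
    else π x

/-- Apply a word of rank toggles; the head of the list is applied last, matching the
convention that in a product `𝐭_{i_1} 𝐭_{i_2} ⋯ 𝐭_{i_k}` the rightmost factor acts first. -/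
def applyB (rk : P → ℕ) : List ℕ → (Phat P → ℝ) → Phat P → ℝ
  | [] => fun π => π
  | i :: w => fun π => rankToggleB rk i (applyB rk w π)

/-- The word `𝐭_0 𝐭_1 ⋯ 𝐭_r` for rowmotion. -/
def rowWordB (r : ℕ) : List ℕ := List.range (r + 1)

/-- The word `(𝐭_r)(𝐭_{r-1} 𝐭_r) ⋯ (𝐭_0 𝐭_1 ⋯ 𝐭_r)` for rowvacuation. -/
def rvacWordB (r : ℕ) : List ℕ :=
  (List.range (r + 1)).foldr (fun k acc => (List.range (r + 1)).drop (r - k) ++ acc) []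

/-- The word `(𝐭_0)(𝐭_1 𝐭_0) ⋯ (𝐭_r 𝐭_{r-1} ⋯ 𝐭_0)` for dual rowvacuation. -/
def drvacWordB (r : ℕ) : List ℕ :=
  (List.range (r + 1)).foldr (fun k acc => (List.range (k + 1)).reverse ++ acc) []

/-- Birational order filter rowmotion `Row^B_F = 𝐭_0 𝐭_1 ⋯ 𝐭_r`. -/
def RowB (rk : P → ℕ) (r : ℕ) : (Phat P → ℝ) → Phat P → ℝ := applyB rk (rowWordB r)

/-- The inverse of birational order filter rowmotion, `(Row^B_F)⁻¹ = 𝐭_r ⋯ 𝐭_1 𝐭_0`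
(each toggle is an involution, so the reversed word gives the inverse map). -/
def RowInvB (rk : P → ℕ) (r : ℕ) : (Phat P → ℝ) → Phat P → ℝ := applyB rk (rowWordB r).reverse

/-- Birational order filter rowvacuation `Rvac^B_F`. -/
def RvacB (rk : P → ℕ) (r : ℕ) : (Phat P → ℝ) → Phat P → ℝ := applyB rk (rvacWordB r)

/-- Birational order filter dual rowvacuation `DRvac^B_F`. -/
def DRvacB (rk : P → ℕ) (r : ℕ) : (Phat P → ℝ) → Phat P → ℝ := applyB rk (drvacWordB r)

end

noncomputable section

variable {P : Type} [Fintype P] [PartialOrder P]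

/-- The sum, over all maximal chains `C` of `P` containing `p`, of `∏_{y ∈ C} π(y)`. -/
def chainSum (π : P → ℝ) (p : P) : ℝ :=
  ∑ C ∈ Finset.univ.filter
      (fun C : Finset P => IsMaxChain (· ≤ ·) (C : Set P) ∧ p ∈ C),
    ∏ y ∈ C, π y

/-- The birational antichain rank toggle `𝛕_i`, in simultaneous form (it agrees with the
composition of the pairwise commuting birational antichain toggles `τ_p` over `p ∈ P_i`,
since in a graded poset no maximal chain contains two distinct elements of the same rank). -/
def arankToggleB (κ : ℝ) (rk : P → ℕ) (i : ℕ) (π : P → ℝ) : P → ℝ :=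
  fun x => if rk x = i then κ / chainSum π x else π x

/-- Apply a word of antichain rank toggles; the head of the list is applied last. -/
def aApplyB (κ : ℝ) (rk : P → ℕ) : List ℕ → (P → ℝ) → P → ℝ
  | [] => fun π => π
  | i :: w => fun π => arankToggleB κ rk i (aApplyB κ rk w π)

/-- The word `𝛕_r 𝛕_{r-1} ⋯ 𝛕_0` for antichain rowmotion. -/
def arowWordB (r : ℕ) : List ℕ := (List.range (r + 1)).reverse

/-- The word `(𝛕_r)(𝛕_r 𝛕_{r-1}) ⋯ (𝛕_r 𝛕_{r-1} ⋯ 𝛕_1 𝛕_0)` for antichain rowvacuation. -/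
def arvacWordB (r : ℕ) : List ℕ :=
  (List.range (r + 1)).foldr
    (fun k acc => (List.range (r + 1)).reverse.take (k + 1) ++ acc) []

/-- Birational antichain rowmotion `Row^B_A = 𝛕_r 𝛕_{r-1} ⋯ 𝛕_0`. -/
def RowAB (κ : ℝ) (rk : P → ℕ) (r : ℕ) : (P → ℝ) → P → ℝ := aApplyB κ rk (arowWordB r)

/-- Birational antichain rowvacuation `Rvac^B_A`. -/
def RvacAB (κ : ℝ) (rk : P → ℕ) (r : ℕ) : (P → ℝ) → P → ℝ := aApplyB κ rk (arvacWordB r)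

end

/-- The underlying set of the poset `Aⁿ`: pairs `(i,j)` with `1 ≤ i ≤ j ≤ n`,
representing the intervals `[i,j] ⊆ [n]`. -/
def AnP (n : ℕ) : Type := {p : ℕ × ℕ // 1 ≤ p.1 ∧ p.1 ≤ p.2 ∧ p.2 ≤ n}

/-- `Aⁿ` is ordered by containment of intervals. -/
instance (n : ℕ) : PartialOrder (AnP n) where
  le x y := y.val.1 ≤ x.val.1 ∧ x.val.2 ≤ y.val.2
  le_refl x := ⟨le_refl _, le_refl _⟩
  le_trans x y z h1 h2 := ⟨le_trans h2.1 h1.1, le_trans h1.2 h2.2⟩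
  le_antisymm x y h1 h2 :=
    Subtype.ext (Prod.ext_iff.mpr ⟨le_antisymm h2.1 h1.1, le_antisymm h1.2 h2.2⟩)

instance (n : ℕ) : Fintype (AnP n) :=
  Fintype.subtype
    ((Finset.Icc 1 n ×ˢ Finset.Icc 1 n).filter (fun p => 1 ≤ p.1 ∧ p.1 ≤ p.2 ∧ p.2 ≤ n))
    (by
      intro x
      simp only [Finset.mem_filter, Finset.mem_product, Finset.mem_Icc]
      omega)

/-- The rank function of `Aⁿ`: `rk [i,j] = j - i`; `Aⁿ` is graded of rank `n - 1`. -/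
def rkAn (n : ℕ) : AnP n → ℕ := fun p => p.val.2 - p.val.1

noncomputable section

/-- The birational Lalanne–Kreweras involution `LK^B`: birational antichain rowvacuation of
the graded poset `Aⁿ` (of rank `n - 1`), acting on `A^B_κ(Aⁿ) = (ℝ>0)^(Aⁿ)`. -/
def LKB (n : ℕ) (κ : ℝ) : (AnP n → ℝ) → AnP n → ℝ := RvacAB κ (rkAn n) (n - 1)

/-- The statistic `h^B_i(π) = ∏_{j=i}^n π([i,j]) · ∏_{j=1}^i π([j,i])`. -/
def hB (n i : ℕ) (π : AnP n → ℝ) : ℝ :=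
  (∏ p ∈ Finset.univ.filter (fun p : AnP n => p.val.1 = i), π p) *
  (∏ p ∈ Finset.univ.filter (fun p : AnP n => p.val.2 = i), π p)

end

section ChainSums

variable {P : Type} [PartialOrder P]

/-- `C` is a maximal chain of the subposet `S`. -/
def IsMaxChainIn (S : Set P) (C : Finset P) : Prop :=
  (∀ c ∈ C, c ∈ S) ∧ (∀ a ∈ C, ∀ b ∈ C, a ≤ b ∨ b ≤ a) ∧
    ∀ z ∈ S, (∀ c ∈ C, z ≤ c ∨ c ≤ z) → z ∈ C

lemma isMaxChain_iff_isMaxChainIn_univ (C : Finset P) :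
    IsMaxChain (· ≤ ·) (C : Set P) ↔ IsMaxChainIn Set.univ C := by
  constructor
  · rintro ⟨hc, hm⟩
    refine ⟨fun _ _ => Set.mem_univ _, fun a ha b hb => hc.total ha hb, fun z _ hz => ?_⟩
    have h := hm (hc.insert (a := z) fun b hb _ => hz b hb) (Set.subset_insert _ _)
    have : z ∈ (C : Set P) := by rw [h]; exact Set.mem_insert _ _
    exact this
  · rintro ⟨-, hc, hm⟩
    refine ⟨fun a ha b hb _ => hc a ha b hb, fun T hT hCT => hCT.antisymm fun z hz => ?_⟩
    exact hm z trivial fun c hc' => hT.total hz (hCT hc')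

lemma isMaxChainIn_insert_union {x : P} {A B : Finset P}
    (hA : IsMaxChainIn (Set.Iio x) A) (hB : IsMaxChainIn (Set.Ioi x) B) :
    IsMaxChainIn Set.univ (insert x (A ∪ B)) := by
  obtain ⟨hA1, hA2, hA3⟩ := hA
  obtain ⟨hB1, hB2, hB3⟩ := hB
  simp only [Set.mem_Iio, Set.mem_Ioi] at hA1 hB1 hA3 hB3
  refine ⟨fun _ _ => trivial, ?_, ?_⟩
  · intro a ha b hb
    simp only [Finset.mem_insert, Finset.mem_union] at ha hb
    rcases ha with rfl | ha | ha <;> rcases hb with rfl | hb | hb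
    · exact Or.inl le_rfl
    · exact Or.inr (hA1 b hb).le
    · exact Or.inl (hB1 b hb).le
    · exact Or.inl (hA1 a ha).le
    · exact hA2 a ha b hb
    · exact Or.inl ((hA1 a ha).trans (hB1 b hb)).le
    · exact Or.inr (hB1 a ha).le
    · exact Or.inr ((hA1 b hb).trans (hB1 a ha)).le
    · exact hB2 a ha b hb
  · intro z _ hz
    simp only [Finset.mem_insert, Finset.mem_union] at hz ⊢
    by_cases hzx : z = x
    · exact Or.inl hzx
    · rcases hz x (Or.inl rfl) with h | h
      · exact Or.inr (Or.inl (hA3 z (lt_of_le_of_ne h hzx)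
          fun c hc => hz c (Or.inr (Or.inl hc))))
      · exact Or.inr (Or.inr (hB3 z (lt_of_le_of_ne h (Ne.symm hzx))
          fun c hc => hz c (Or.inr (Or.inr hc))))

lemma IsMaxChainIn.filter_lt {x : P} {C : Finset P} (hC : IsMaxChainIn Set.univ C)
    (hx : x ∈ C) : IsMaxChainIn (Set.Iio x) (C.filter (· < x)) := by
  obtain ⟨-, h2, h3⟩ := hC
  refine ⟨fun c hc => (Finset.mem_filter.1 hc).2,
    fun a ha b hb => h2 a (Finset.mem_filter.1 ha).1 b (Finset.mem_filter.1 hb).1,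
    fun z hz hzc => Finset.mem_filter.2 ⟨h3 z trivial fun c hc => ?_, hz⟩⟩
  by_cases hcx : c < x
  · exact hzc c (Finset.mem_filter.2 ⟨hc, hcx⟩)
  · have : x ≤ c := by
      rcases h2 x hx c hc with h | h
      · exact h
      · rcases h.lt_or_eq with h | h
        · exact absurd h hcx
        · exact h.ge
    exact Or.inl ((le_of_lt hz).trans this)

lemma IsMaxChainIn.filter_gt {x : P} {C : Finset P} (hC : IsMaxChainIn Set.univ C)
    (hx : x ∈ C) : IsMaxChainIn (Set.Ioi x) (C.filter (x < ·)) := by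
  obtain ⟨-, h2, h3⟩ := hC
  refine ⟨fun c hc => (Finset.mem_filter.1 hc).2,
    fun a ha b hb => h2 a (Finset.mem_filter.1 ha).1 b (Finset.mem_filter.1 hb).1,
    fun z hz hzc => Finset.mem_filter.2 ⟨h3 z trivial fun c hc => ?_, hz⟩⟩
  by_cases hcx : x < c
  · exact hzc c (Finset.mem_filter.2 ⟨hc, hcx⟩)
  · have : c ≤ x := by
      rcases h2 x hx c hc with h | h
      · rcases h.lt_or_eq with h | h
        · exact absurd h hcx
        · exact h.ge
      · exact h
    exact Or.inr (this.trans (le_of_lt hz))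

lemma IsMaxChainIn.insert_of_covBy {x y : P} {C : Finset P} (hyx : y ⋖ x)
    (hC : IsMaxChainIn (Set.Iio y) C) : IsMaxChainIn (Set.Iio x) (insert y C) := by
  obtain ⟨h1, h2, h3⟩ := hC
  refine ⟨?_, ?_, ?_⟩
  · intro c hc
    rcases Finset.mem_insert.1 hc with rfl | hc
    · exact hyx.lt
    · exact (h1 c hc).trans hyx.lt
  · intro a ha b hb
    rw [Finset.mem_insert] at ha hb
    rcases ha with rfl | ha <;> rcases hb with rfl | hb
    · exact Or.inl le_rfl
    · exact Or.inr (h1 b hb).le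
    · exact Or.inl (h1 a ha).le
    · exact h2 a ha b hb
  · intro z hz hzc
    by_cases hzy : z = y
    · exact Finset.mem_insert.2 (Or.inl hzy)
    · refine Finset.mem_insert_of_mem (h3 z ?_ fun c hc => hzc c (Finset.mem_insert_of_mem hc))
      rcases hzc y (Finset.mem_insert_self _ _) with h | h
      · exact lt_of_le_of_ne h hzy
      · exact absurd hz (hyx.2 (lt_of_le_of_ne h (Ne.symm hzy)))

lemma IsMaxChainIn.exists_covBy [Finite P] {x : P} {C : Finset P}
    (hC : IsMaxChainIn (Set.Iio x) C) (hx : ¬ IsMin x) :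
    ∃ y, y ⋖ x ∧ y ∈ C ∧ IsMaxChainIn (Set.Iio y) (C.erase y) := by
  obtain ⟨h1, h2, h3⟩ := hC
  have hne : C.Nonempty := by
    by_contra h
    rw [Finset.not_nonempty_iff_eq_empty] at h
    subst h
    rw [not_isMin_iff] at hx
    obtain ⟨z, hz⟩ := hx
    exact absurd (h3 z hz (by simp)) (by simp)
  obtain ⟨y, hy, hmax⟩ := C.exists_maximal hne
  have hle : ∀ c ∈ C, c ≤ y := fun c hc => (h2 c hc y hy).elim id fun h => hmax hc h
  refine ⟨y, ⟨h1 y hy, fun z hyz hzx => ?_⟩, hy, ?_, ?_, ?_⟩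
  · exact absurd (hle z (h3 z hzx fun c hc => Or.inr ((hle c hc).trans hyz.le))) hyz.not_ge
  · intro c hc
    exact lt_of_le_of_ne (hle c (Finset.mem_of_mem_erase hc)) (Finset.ne_of_mem_erase hc)
  · exact fun a ha b hb => h2 a (Finset.mem_of_mem_erase ha) b (Finset.mem_of_mem_erase hb)
  · intro z hz hzc
    refine Finset.mem_erase.2 ⟨ne_of_lt hz, h3 z (lt_trans hz (h1 y hy)) fun c hc => ?_⟩
    by_cases hcy : c = y
    · exact Or.inl (hcy ▸ le_of_lt hz)
    · exact hzc c (Finset.mem_erase.2 ⟨hcy, hc⟩)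

variable [Fintype P]

/-- The sum of `∏_{y ∈ C} π(y)` over the maximal chains `C` of `{y | y < x}`. -/
noncomputable def lowerSum (π : P → ℝ) (x : P) : ℝ :=
  ∑ C ∈ Finset.univ.filter (fun C : Finset P => IsMaxChainIn (Set.Iio x) C), ∏ y ∈ C, π y

/-- The sum of `∏_{y ∈ C} π(y)` over the maximal chains `C` of `{y | x < y}`. -/
noncomputable def upperSum (π : P → ℝ) (x : P) : ℝ :=
  ∑ C ∈ Finset.univ.filter (fun C : Finset P => IsMaxChainIn (Set.Ioi x) C), ∏ y ∈ C, π y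

lemma chainSum_eq (π : P → ℝ) (x : P) :
    chainSum π x = π x * lowerSum π x * upperSum π x := by
  rw [mul_assoc, lowerSum, upperSum, Finset.sum_mul_sum, ← Finset.sum_product',
    Finset.mul_sum, chainSum]
  refine Finset.sum_nbij' (fun C => (C.filter (· < x), C.filter (x < ·)))
    (fun AB => insert x (AB.1 ∪ AB.2)) ?_ ?_ ?_ ?_ ?_
  · intro C hC
    simp only [Finset.mem_filter, Finset.mem_univ, true_and, Finset.mem_product,
      isMaxChain_iff_isMaxChainIn_univ] at hC ⊢
    exact ⟨hC.1.filter_lt hC.2, hC.1.filter_gt hC.2⟩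
  · intro AB h
    simp only [Finset.mem_filter, Finset.mem_univ, true_and, Finset.mem_product,
      isMaxChain_iff_isMaxChainIn_univ] at h ⊢
    exact ⟨isMaxChainIn_insert_union h.1 h.2, Finset.mem_insert_self _ _⟩
  · intro C hC
    simp only [Finset.mem_filter, Finset.mem_univ, true_and,
      isMaxChain_iff_isMaxChainIn_univ] at hC
    ext z
    simp only [Finset.mem_insert, Finset.mem_union, Finset.mem_filter]
    constructor
    · rintro (rfl | h | h)
      exacts [hC.2, h.1, h.1]
    · intro hz
      rcases hC.1.2.1 z hz x hC.2 with h | h <;> rcases h.lt_or_eq with h' | h'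
      · exact Or.inr (Or.inl ⟨hz, h'⟩)
      · exact Or.inl h'
      · exact Or.inr (Or.inr ⟨hz, h'⟩)
      · exact Or.inl h'.symm
  · rintro ⟨A, B⟩ h
    simp only [Finset.mem_filter, Finset.mem_univ, true_and, Finset.mem_product] at h
    obtain ⟨⟨hA, -⟩, ⟨hB, -⟩⟩ := h
    simp only [Set.mem_Iio, Set.mem_Ioi] at hA hB
    refine Prod.ext ?_ ?_
    · ext z
      simp only [Finset.mem_insert, Finset.mem_union, Finset.mem_filter]
      constructor
      · rintro ⟨rfl | h | h, hz⟩
        exacts [absurd hz (lt_irrefl _), h, absurd (hz.trans (hB z h)) (lt_irrefl _)]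
      · exact fun h => ⟨Or.inr (Or.inl h), hA z h⟩
    · ext z
      simp only [Finset.mem_insert, Finset.mem_union, Finset.mem_filter]
      constructor
      · rintro ⟨rfl | h | h, hz⟩
        exacts [absurd hz (lt_irrefl _), absurd (hz.trans (hA z h)) (lt_irrefl _), h]
      · exact fun h => ⟨Or.inr (Or.inr h), hB z h⟩
  · intro C hC
    simp only [Finset.mem_filter, Finset.mem_univ, true_and,
      isMaxChain_iff_isMaxChainIn_univ] at hC
    rw [← Finset.prod_union, ← Finset.prod_insert]
    · refine Finset.prod_congr ?_ fun _ _ => rfl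
      ext z
      simp only [Finset.mem_insert, Finset.mem_union, Finset.mem_filter]
      constructor
      · intro hz
        rcases hC.1.2.1 z hz x hC.2 with h | h <;> rcases h.lt_or_eq with h' | h'
        · exact Or.inr (Or.inl ⟨hz, h'⟩)
        · exact Or.inl h'
        · exact Or.inr (Or.inr ⟨hz, h'⟩)
        · exact Or.inl h'.symm
      · rintro (rfl | h | h)
        exacts [hC.2, h.1, h.1]
    · simp
    · rw [Finset.disjoint_left]
      intro z hz hz'
      exact lt_asymm (Finset.mem_filter.1 hz).2 (Finset.mem_filter.1 hz').2

lemma lowerSum_of_isMin (π : P → ℝ) {x : P} (hx : IsMin x) : lowerSum π x = 1 := by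
  have h : Finset.univ.filter (fun C : Finset P => IsMaxChainIn (Set.Iio x) C) = {∅} := by
    ext C
    simp only [Finset.mem_filter, Finset.mem_univ, true_and, Finset.mem_singleton]
    constructor
    · intro hC
      exact Finset.eq_empty_of_forall_notMem fun c hc => hx.not_lt (hC.1 c hc)
    · rintro rfl
      exact ⟨by simp, by simp, fun z hz => absurd hz hx.not_lt⟩
  rw [lowerSum, h]
  simp

lemma lowerSum_of_not_isMin (π : P → ℝ) {x : P} (hx : ¬ IsMin x) :
    lowerSum π x = ∑ y ∈ Finset.univ.filter (· ⋖ x), π y * lowerSum π y := by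
  simp only [lowerSum, Finset.mul_sum]
  rw [Finset.sum_sigma', eq_comm]
  refine Finset.sum_bij (fun yC _ => insert yC.1 yC.2) ?_ ?_ ?_ ?_
  · rintro ⟨y, C⟩ h
    simp only [Finset.mem_sigma, Finset.mem_filter, Finset.mem_univ, true_and] at h ⊢
    exact h.2.insert_of_covBy h.1
  · rintro ⟨y, C⟩ h ⟨z, D⟩ h' heq
    simp only [Finset.mem_sigma, Finset.mem_filter, Finset.mem_univ, true_and] at h h' heq
    have hyC : y ∉ C := fun hy => lt_irrefl _ (h.2.1 y hy)
    have hzD : z ∉ D := fun hz => lt_irrefl _ (h'.2.1 z hz)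
    have hyz : y = z := by
      have h1 : y ∈ insert z D := heq ▸ Finset.mem_insert_self _ _
      have h2 : z ∈ insert y C := heq ▸ Finset.mem_insert_self _ _
      rcases Finset.mem_insert.1 h1 with h1 | h1
      · exact h1
      · rcases Finset.mem_insert.1 h2 with h2 | h2
        · exact h2.symm
        · exact absurd (h'.2.1 y h1) (lt_asymm (h.2.1 z h2))
    subst hyz
    have : C = D := by rw [← Finset.erase_insert hyC, heq, Finset.erase_insert hzD]
    rw [this]
  · intro C hC
    simp only [Finset.mem_filter, Finset.mem_univ, true_and] at hC
    obtain ⟨y, hyx, hy, hC'⟩ := hC.exists_covBy hx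
    exact ⟨⟨y, C.erase y⟩, by simpa using ⟨hyx, hC'⟩, Finset.insert_erase hy⟩
  · rintro ⟨y, C⟩ h
    simp only [Finset.mem_sigma, Finset.mem_filter, Finset.mem_univ, true_and] at h
    exact (Finset.prod_insert fun hy => lt_irrefl _ (h.2.1 y hy)).symm

lemma upperSum_eq_lowerSum_dual (π : P → ℝ) (x : P) :
    upperSum π x = lowerSum (P := Pᵒᵈ) (fun y => π (OrderDual.ofDual y)) (OrderDual.toDual x) := by
  have key (C : Finset P) : IsMaxChainIn (Set.Ioi x) C ↔
      IsMaxChainIn (P := Pᵒᵈ) (Set.Iio (OrderDual.toDual x)) C := by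
    constructor
    · rintro ⟨h1, h2, h3⟩
      exact ⟨h1, fun a ha b hb => (h2 a ha b hb).symm,
        fun z hz hc => h3 z hz fun c hc' => (hc c hc').symm⟩
    · rintro ⟨h1, h2, h3⟩
      exact ⟨h1, fun a ha b hb => (h2 a ha b hb).symm,
        fun z hz hc => h3 z hz fun c hc' => (hc c hc').symm⟩
  refine Finset.sum_bij (fun (C : Finset P) _ => (show Finset Pᵒᵈ from C))
    (fun C hC => ?_) (fun _ _ _ _ h => h) (fun C hC => ?_) fun _ _ => rfl
  · exact Finset.mem_filter.2 ⟨Finset.mem_univ _, (key C).1 (Finset.mem_filter.1 hC).2⟩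
  · exact ⟨C, Finset.mem_filter.2 ⟨Finset.mem_univ _, (key C).2 (Finset.mem_filter.1 hC).2⟩, rfl⟩

lemma upperSum_of_isMax (π : P → ℝ) {x : P} (hx : IsMax x) : upperSum π x = 1 := by
  rw [upperSum_eq_lowerSum_dual]
  exact lowerSum_of_isMin _ hx.toDual

lemma upperSum_of_not_isMax (π : P → ℝ) {x : P} (hx : ¬ IsMax x) :
    upperSum π x = ∑ y ∈ Finset.univ.filter (x ⋖ ·), π y * upperSum π y := by
  rw [upperSum_eq_lowerSum_dual, lowerSum_of_not_isMin _ (fun h => hx (isMin_toDual_iff.1 h))]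
  have key (y : P) : OrderDual.toDual y ⋖ OrderDual.toDual x ↔ x ⋖ y := toDual_covBy_toDual_iff
  refine Finset.sum_bij (fun (y : Pᵒᵈ) _ => OrderDual.ofDual y)
    (fun y hy => ?_) (fun _ _ _ _ h => h) (fun y hy => ?_) fun y _ => ?_
  · exact Finset.mem_filter.2 ⟨Finset.mem_univ _, (key y).1 (Finset.mem_filter.1 hy).2⟩
  · exact ⟨y, Finset.mem_filter.2 ⟨Finset.mem_univ _, (key y).2 (Finset.mem_filter.1 hy).2⟩, rfl⟩
  · rw [upperSum_eq_lowerSum_dual]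
    rfl

lemma lowerSum_congr {π σ : P → ℝ} {x : P} (h : ∀ y < x, π y = σ y) :
    lowerSum π x = lowerSum σ x :=
  Finset.sum_congr rfl fun _ hC =>
    Finset.prod_congr rfl fun y hy => h y ((Finset.mem_filter.1 hC).2.1 y hy)

lemma upperSum_congr {π σ : P → ℝ} {x : P} (h : ∀ y, x < y → π y = σ y) :
    upperSum π x = upperSum σ x :=
  Finset.sum_congr rfl fun _ hC =>
    Finset.prod_congr rfl fun y hy => h y ((Finset.mem_filter.1 hC).2.1 y hy)

lemma lowerSum_pos {π : P → ℝ} (hπ : ∀ y, 0 < π y) (x : P) : 0 < lowerSum π x := by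
  induction x using WellFoundedLT.induction with
  | ind x ih =>
    by_cases hx : IsMin x
    · rw [lowerSum_of_isMin π hx]
      exact one_pos
    · rw [lowerSum_of_not_isMin π hx]
      refine Finset.sum_pos (fun y hy => mul_pos (hπ y) (ih y (Finset.mem_filter.1 hy).2.lt)) ?_
      obtain ⟨z, hz⟩ := not_isMin_iff.1 hx
      obtain ⟨y, -, hy⟩ := exists_le_covBy_of_lt hz
      exact ⟨y, by simpa using hy⟩

lemma upperSum_pos {π : P → ℝ} (hπ : ∀ y, 0 < π y) (x : P) : 0 < upperSum π x := by
  rw [upperSum_eq_lowerSum_dual]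
  exact lowerSum_pos (fun y => hπ _) _

end ChainSums

section Rowvacuation

variable {P : Type} [PartialOrder P] [Fintype P]

/-- The lower transfer map: the sum of `∏_{y ∈ C} π(y)` over the maximal chains `C` of
`{y | y ≤ x}`. -/
noncomputable def lowerTransfer (π : P → ℝ) (x : P) : ℝ := π x * lowerSum π x

/-- The upper transfer map: the sum of `∏_{y ∈ C} π(y)` over the maximal chains `C` of
`{y | x ≤ y}`. -/
noncomputable def upperTransfer (π : P → ℝ) (x : P) : ℝ := π x * upperSum π x

lemma lowerTransfer_congr {π σ : P → ℝ} {x : P} (h : ∀ y ≤ x, π y = σ y) :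
    lowerTransfer π x = lowerTransfer σ x := by
  rw [lowerTransfer, lowerTransfer, h x le_rfl, lowerSum_congr fun y hy => h y hy.le]

lemma upperTransfer_congr {π σ : P → ℝ} {x : P} (h : ∀ y, x ≤ y → π y = σ y) :
    upperTransfer π x = upperTransfer σ x := by
  rw [upperTransfer, upperTransfer, h x le_rfl, upperSum_congr fun y hy => h y hy.le]

lemma lowerTransfer_pos {π : P → ℝ} (hπ : ∀ y, 0 < π y) (x : P) : 0 < lowerTransfer π x :=
  mul_pos (hπ x) (lowerSum_pos hπ x)

lemma upperTransfer_pos {π : P → ℝ} (hπ : ∀ y, 0 < π y) (x : P) : 0 < upperTransfer π x :=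
  mul_pos (hπ x) (upperSum_pos hπ x)

lemma lowerSum_congr_of_lowerTransfer {π σ : P → ℝ} {x : P}
    (h : ∀ y, y ⋖ x → lowerTransfer π y = lowerTransfer σ y) : lowerSum π x = lowerSum σ x := by
  by_cases hx : IsMin x
  · rw [lowerSum_of_isMin _ hx, lowerSum_of_isMin _ hx]
  · rw [lowerSum_of_not_isMin _ hx, lowerSum_of_not_isMin _ hx]
    exact Finset.sum_congr rfl fun y hy => h y (Finset.mem_filter.1 hy).2

lemma upperSum_congr_of_upperTransfer {π σ : P → ℝ} {x : P}
    (h : ∀ y, x ⋖ y → upperTransfer π y = upperTransfer σ y) : upperSum π x = upperSum σ x := by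
  by_cases hx : IsMax x
  · rw [upperSum_of_isMax _ hx, upperSum_of_isMax _ hx]
  · rw [upperSum_of_not_isMax _ hx, upperSum_of_not_isMax _ hx]
    exact Finset.sum_congr rfl fun y hy => h y (Finset.mem_filter.1 hy).2

lemma eq_of_lowerTransfer_eq {π σ : P → ℝ} (hσ : ∀ y, 0 < σ y) {x : P}
    (h : ∀ y, y = x ∨ y ⋖ x → lowerTransfer π y = lowerTransfer σ y) : π x = σ x := by
  have h1 := h x (Or.inl rfl)
  rw [lowerTransfer, lowerTransfer,
    lowerSum_congr_of_lowerTransfer fun y hy => h y (Or.inr hy)] at h1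
  exact mul_right_cancel₀ (lowerSum_pos hσ x).ne' h1

lemma aApplyB_append (κ : ℝ) (rk : P → ℕ) (v w : List ℕ) (π : P → ℝ) :
    aApplyB κ rk (v ++ w) π = aApplyB κ rk v (aApplyB κ rk w π) := by
  induction v with
  | nil => rfl
  | cons i v ih => simp only [List.cons_append, aApplyB, ih]

/-- The effect of toggling the ranks `k, k + 1, …, k + s - 1` in this order. -/
lemma aApplyB_range'_reverse {κ : ℝ} (hκ : 0 < κ) {rk : P → ℕ} (hrk : StrictMono rk) (k s : ℕ)
    {π : P → ℝ} (hπ : ∀ x, 0 < π x) :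
    (∀ x, 0 < aApplyB κ rk (List.range' k s).reverse π x) ∧
    (∀ x, rk x < k ∨ k + s ≤ rk x → aApplyB κ rk (List.range' k s).reverse π x = π x) ∧
    ∀ x, k ≤ rk x → rk x < k + s →
      lowerTransfer (aApplyB κ rk (List.range' k s).reverse π) x * upperTransfer π x = κ := by
  induction s with
  | zero =>
    refine ⟨hπ, fun _ _ => rfl, fun x h1 h2 => ?_⟩
    omega
  | succ s ih =>
    obtain ⟨ih1, ih2, ih3⟩ := ih
    rw [List.range'_1_concat, List.reverse_append, List.reverse_singleton, List.singleton_append]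
    simp only [aApplyB]
    set σ := aApplyB κ rk (List.range' k s).reverse π
    have hfix : ∀ x, rk x ≠ k + s → arankToggleB κ rk (k + s) σ x = σ x :=
      fun x hx => if_neg hx
    refine ⟨fun x => ?_, fun x hx => ?_, fun x h1 h2 => ?_⟩
    · unfold arankToggleB
      split_ifs
      · rw [chainSum_eq]
        exact div_pos hκ (mul_pos (mul_pos (ih1 x) (lowerSum_pos ih1 x)) (upperSum_pos ih1 x))
      · exact ih1 x
    · rw [hfix x (by omega), ih2 x (by omega)]
    · rcases (show rk x < k + s ∨ rk x = k + s by omega) with h | h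
      · rw [lowerTransfer_congr (σ := σ) fun y hy => hfix y ?_]
        · exact ih3 x h1 h
        · have := hrk.monotone hy
          omega
      · have hx : arankToggleB κ rk (k + s) σ x = κ / chainSum σ x := if_pos h
        rw [lowerTransfer, hx, chainSum_eq, ih2 x (by omega),
          upperSum_congr (π := σ) (σ := π) fun y hy => ih2 y ?_,
          lowerSum_congr (σ := σ) fun y hy => hfix y ?_, upperTransfer]
        · have h3 := lowerSum_pos ih1 x
          have h4 := upperSum_pos hπ x
          have h5 := hπ x
          field_simp
        · have := hrk hy
          omega
        · have := hrk hy
          omega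

lemma arowWordB_eq (r : ℕ) : arowWordB r = (List.range' 0 (r + 1)).reverse := by
  rw [arowWordB, List.range_eq_range']

lemma take_reverse_range {r k : ℕ} (hk : k ≤ r) :
    (List.range (r + 1)).reverse.take (k + 1) = (List.range' (r - k) (k + 1)).reverse := by
  rw [List.take_reverse, List.range_eq_range', List.drop_range', List.length_range']
  congr 2 <;> omega

lemma RowAB_pos {κ : ℝ} (hκ : 0 < κ) {rk : P → ℕ} (hrk : StrictMono rk) (r : ℕ)
    {π : P → ℝ} (hπ : ∀ x, 0 < π x) (x : P) : 0 < RowAB κ rk r π x := by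
  rw [RowAB, arowWordB_eq]
  exact (aApplyB_range'_reverse hκ hrk 0 (r + 1) hπ).1 x

lemma iterate_RowAB_pos {κ : ℝ} (hκ : 0 < κ) {rk : P → ℕ} (hrk : StrictMono rk) (r m : ℕ)
    {π : P → ℝ} (hπ : ∀ x, 0 < π x) : ∀ x, 0 < (RowAB κ rk r)^[m] π x := by
  induction m with
  | zero => exact hπ
  | succ m ih =>
    rw [Function.iterate_succ_apply']
    exact RowAB_pos hκ hrk r ih

/-- Antichain rowmotion in terms of the transfer maps. -/
lemma lowerTransfer_RowAB_mul {κ : ℝ} (hκ : 0 < κ) {rk : P → ℕ} (hrk : StrictMono rk) {r : ℕ}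
    (hr : ∀ x, rk x ≤ r) {π : P → ℝ} (hπ : ∀ x, 0 < π x) (x : P) :
    lowerTransfer (RowAB κ rk r π) x * upperTransfer π x = κ := by
  rw [RowAB, arowWordB_eq]
  exact (aApplyB_range'_reverse hκ hrk 0 (r + 1) hπ).2.2 x (Nat.zero_le _)
    (by have := hr x; omega)

lemma partial_rowvacuation {κ : ℝ} (hκ : 0 < κ) {rk : P → ℕ} (hrk : StrictMono rk) {r : ℕ}
    (hr : ∀ x, rk x ≤ r) (hcov : ∀ x y, y ⋖ x → rk x = rk y + 1) {π : P → ℝ}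
    (hπ : ∀ x, 0 < π x) (s : ℕ) (hs : s ≤ r) (σ : P → ℝ)
    (hσ : σ = aApplyB κ rk ((List.range' (r - s) (s + 1)).foldr
      (fun k acc => (List.range (r + 1)).reverse.take (k + 1) ++ acc) []) π) :
    (∀ x, 0 < σ x) ∧
    (∀ x, s ≤ rk x → lowerTransfer σ x = lowerTransfer ((RowAB κ rk r)^[s + 1] π) x) ∧
    ∀ x, rk x ≤ s → lowerTransfer σ x = lowerTransfer ((RowAB κ rk r)^[rk x + 1] π) x := by
  induction s generalizing σ with
  | zero =>
    have h : σ = RowAB κ rk r π := by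
      rw [hσ, RowAB, arowWordB]
      simp [List.take_of_length_le]
    subst h
    refine ⟨RowAB_pos hκ hrk r hπ, fun x _ => rfl, fun x hx => ?_⟩
    rw [Nat.le_zero.1 hx]
    rfl
  | succ s ih =>
    obtain ⟨ih1, ih2, ih3⟩ := ih (by omega) _ rfl
    rw [List.range'_succ, List.foldr_cons, aApplyB_append,
      take_reverse_range (show r - (s + 1) ≤ r by omega),
      show r - (r - (s + 1)) = s + 1 by omega] at hσ
    rw [show r - s = r - (s + 1) + 1 by omega] at ih1 ih2 ih3
    set τ := aApplyB κ rk ((List.range' (r - (s + 1) + 1) (s + 1)).foldr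
      (fun k acc => (List.range (r + 1)).reverse.take (k + 1) ++ acc) []) π
    obtain ⟨h1, h2, h3⟩ := aApplyB_range'_reverse hκ hrk (s + 1) (r - (s + 1) + 1) ih1
    rw [← hσ] at h1 h2 h3
    have hρ := iterate_RowAB_pos hκ hrk r (s + 1) hπ
    set ρ := (RowAB κ rk r)^[s + 1] π with hρdef
    have hup : ∀ x, s + 1 ≤ rk x → lowerTransfer σ x = lowerTransfer (RowAB κ rk r ρ) x := by
      intro x hx
      have h4 := h3 x hx (by have := hr x; omega)
      have h5 := lowerTransfer_RowAB_mul hκ hrk hr hρ x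
      rw [upperTransfer_congr (σ := ρ) fun y hy => ?_] at h4
      · exact mul_right_cancel₀ (upperTransfer_pos hρ x).ne' (h4.trans h5.symm)
      · refine eq_of_lowerTransfer_eq hρ ?_
        have hy' := hrk.monotone hy
        rintro z (rfl | hz)
        · exact ih2 z (by omega)
        · have := hcov y z hz
          exact ih2 z (by omega)
    refine ⟨h1, fun x hx => ?_, fun x hx => ?_⟩
    · rw [hup x hx, Function.iterate_succ_apply']
    · rcases (show rk x < s + 1 ∨ rk x = s + 1 by omega) with h | h
      · rw [lowerTransfer_congr (σ := τ) fun y hy => h2 y ?_]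
        · exact ih3 x (by omega)
        · have := hrk.monotone hy
          omega
      · rw [hup x (by omega), h, Function.iterate_succ_apply' _ (s + 1)]

lemma RvacAB_eq (κ : ℝ) (rk : P → ℕ) (r : ℕ) (π : P → ℝ) :
    RvacAB κ rk r π = aApplyB κ rk ((List.range' (r - r) (r + 1)).foldr
      (fun k acc => (List.range (r + 1)).reverse.take (k + 1) ++ acc) []) π := by
  rw [RvacAB, arvacWordB, Nat.sub_self, ← List.range_eq_range']

lemma RvacAB_pos {κ : ℝ} (hκ : 0 < κ) {rk : P → ℕ} (hrk : StrictMono rk) {r : ℕ}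
    (hr : ∀ x, rk x ≤ r) (hcov : ∀ x y, y ⋖ x → rk x = rk y + 1) {π : P → ℝ}
    (hπ : ∀ x, 0 < π x) (x : P) : 0 < RvacAB κ rk r π x :=
  (partial_rowvacuation hκ hrk hr hcov hπ r le_rfl _ (RvacAB_eq κ rk r π)).1 x

lemma lowerTransfer_RvacAB {κ : ℝ} (hκ : 0 < κ) {rk : P → ℕ} (hrk : StrictMono rk) {r : ℕ}
    (hr : ∀ x, rk x ≤ r) (hcov : ∀ x y, y ⋖ x → rk x = rk y + 1) {π : P → ℝ}
    (hπ : ∀ x, 0 < π x) (x : P) :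
    lowerTransfer (RvacAB κ rk r π) x = lowerTransfer ((RowAB κ rk r)^[rk x + 1] π) x :=
  (partial_rowvacuation hκ hrk hr hcov hπ r le_rfl _ (RvacAB_eq κ rk r π)).2.2 x (hr x)

/-- Rowvacuation conjugates rowmotion to its inverse. -/
lemma lowerTransfer_RvacAB_mul {κ : ℝ} (hκ : 0 < κ) {rk : P → ℕ} (hrk : StrictMono rk) {r : ℕ}
    (hr : ∀ x, rk x ≤ r) (hcov : ∀ x y, y ⋖ x → rk x = rk y + 1) {π : P → ℝ}
    (hπ : ∀ x, 0 < π x) (x : P) :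
    lowerTransfer (RvacAB κ rk r π) x *
      upperTransfer (RvacAB κ rk r (RowAB κ rk r π)) x = κ := by
  induction x using WellFoundedGT.induction with
  | ind x ih =>
    have hπ' := RowAB_pos hκ hrk r hπ
    have hρ := RvacAB_pos hκ hrk hr hcov hπ
    have hρ' := RvacAB_pos hκ hrk hr hcov hπ'
    have hlow := lowerTransfer_RvacAB hκ hrk hr hcov hπ
    have hlow' := lowerTransfer_RvacAB hκ hrk hr hcov hπ'
    simp only [← Function.iterate_succ_apply] at hlow'
    set ρ := RvacAB κ rk r π
    set ρ' := RvacAB κ rk r (RowAB κ rk r π)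
    have hσ := iterate_RowAB_pos hκ hrk r (rk x + 1) hπ
    have hrow := lowerTransfer_RowAB_mul hκ hrk hr hσ
    simp only [← Function.iterate_succ_apply' (RowAB κ rk r)] at hrow
    have h1 : lowerSum ρ' x = lowerSum ((RowAB κ rk r)^[rk x + 1] π) x := by
      refine lowerSum_congr_of_lowerTransfer fun y hy => ?_
      rw [hlow', hcov x y hy]
    have h2 : upperSum ρ' x = upperSum ((RowAB κ rk r)^[rk x + 1] π) x := by
      refine upperSum_congr_of_upperTransfer fun y hy => ?_
      have h3 := ih y hy.lt
      rw [hlow, hcov y x hy] at h3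
      exact mul_left_cancel₀ (lowerTransfer_pos (iterate_RowAB_pos hκ hrk r _ hπ) y).ne'
        (h3.trans (hrow y).symm)
    have h4 := hlow' x
    have h5 := hrow x
    rw [Nat.succ_eq_add_one] at h4 h5
    rw [← h4, lowerTransfer, h1, upperTransfer] at h5
    rw [hlow, lowerTransfer, upperTransfer, h2]
    refine Eq.trans ?_ h5
    ring

end Rowvacuation

section Triangle

/-- The relation between two labelings `old`, `new` of the triangle `1 ≤ i ≤ j ≤ n` induced by
one step of rowmotion, where `d` is the lower transfer of `new` and `κ / d` is the upper
transfer of `old`. -/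
structure TriangleStep (n : ℕ) (κ : ℝ) (old new d : ℕ → ℕ → ℝ) : Prop where
  pos : ∀ i j, 1 ≤ i → i ≤ j → j ≤ n → 0 < d i j
  new_diag : ∀ i, 1 ≤ i → i ≤ n → new i i = d i i
  new_off_diag : ∀ i j, 1 ≤ i → i < j → j ≤ n → new i j = d i j / (d (i + 1) j + d i (j - 1))
  old_apex : old 1 n = κ / d 1 n
  old_left : ∀ j, 1 ≤ j → j < n → old 1 j = d 1 (j + 1) / d 1 j
  old_right : ∀ i, 1 < i → i ≤ n → old i n = d (i - 1) n / d i n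
  old_inner : ∀ i j, 1 < i → i ≤ j → j < n →
    old i j = ((d i j) * ((d (i - 1) j)⁻¹ + (d i (j + 1))⁻¹))⁻¹

namespace TriangleStep

variable {n : ℕ} {κ : ℝ} {old new d : ℕ → ℕ → ℝ}

lemma reflect (h : TriangleStep n κ old new d) :
    TriangleStep n κ (fun i j => old (n + 1 - j) (n + 1 - i))
      (fun i j => new (n + 1 - j) (n + 1 - i)) (fun i j => d (n + 1 - j) (n + 1 - i)) where
  pos i j h1 h2 h3 := h.pos _ _ (by omega) (by omega) (by omega)
  new_diag i h1 h2 := h.new_diag _ (by omega) (by omega)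
  new_off_diag i j h1 h2 h3 := by
    rw [h.new_off_diag _ _ (by omega) (by omega) (by omega), add_comm (d _ _),
      show n + 1 - j + 1 = n + 1 - (j - 1) by omega, show n + 1 - i - 1 = n + 1 - (i + 1) by omega]
  old_apex := by simpa using h.old_apex
  old_left j h1 h2 := by
    simp only [Nat.add_sub_cancel]
    rw [h.old_right _ (by omega) (by omega), show n + 1 - j - 1 = n + 1 - (j + 1) by omega]
  old_right i h1 h2 := by
    rw [show n + 1 - n = 1 by omega, h.old_left _ (by omega) (by omega),
      show n + 1 - i + 1 = n + 1 - (i - 1) by omega]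
  old_inner i j h1 h2 h3 := by
    rw [h.old_inner _ _ (by omega) (by omega) (by omega), add_comm (d _ _)⁻¹,
      show n + 1 - j - 1 = n + 1 - (j + 1) by omega, show n + 1 - i + 1 = n + 1 - (i - 1) by omega]

lemma prod_column_partial (h : TriangleStep n κ old new d) {i : ℕ} (hi : i < n) (m : ℕ)
    (hm : m + 1 ≤ i) :
    ∏ j ∈ Finset.Icc 1 (m + 1), old j i =
      (∏ j ∈ Finset.Icc 1 m, new j (i + 1)) * (d (m + 1) (i + 1) / d (m + 1) i) := by
  induction m with
  | zero => simp [h.old_left i hm hi]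
  | succ m ih =>
    rw [Finset.prod_Icc_succ_top (by omega), ih (by omega), Finset.prod_Icc_succ_top (by omega),
      h.old_inner _ _ (by omega) hm hi, h.new_off_diag _ _ (by omega) (by omega) (by omega)]
    have h1 := h.pos (m + 1) i (by omega) (by omega) (by omega)
    have h2 := h.pos (m + 1) (i + 1) (by omega) (by omega) (by omega)
    have h3 := h.pos (m + 1 + 1) i (by omega) (by omega) (by omega)
    have h4 := h.pos (m + 1 + 1) (i + 1) (by omega) (by omega) (by omega)
    simp only [Nat.add_sub_cancel]
    field_simp

lemma prod_column (h : TriangleStep n κ old new d) {i : ℕ} (hi1 : 1 ≤ i) (hi : i < n) :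
    ∏ j ∈ Finset.Icc 1 i, old j i =
      (∏ j ∈ Finset.Icc 1 (i + 1), new j (i + 1)) *
        ((d i i)⁻¹ + (d (i + 1) (i + 1))⁻¹) := by
  obtain ⟨m, rfl⟩ : ∃ m, i = m + 1 := ⟨i - 1, by omega⟩
  rw [h.prod_column_partial hi m le_rfl, Finset.prod_Icc_succ_top (by omega),
    Finset.prod_Icc_succ_top (by omega), h.new_diag _ (by omega) (by omega),
    h.new_off_diag _ _ (by omega) (by omega) (by omega)]
  have h1 := h.pos (m + 1) (m + 1) (by omega) (by omega) (by omega)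
  have h2 := h.pos (m + 1) (m + 1 + 1) (by omega) (by omega) (by omega)
  have h4 := h.pos (m + 1 + 1) (m + 1 + 1) (by omega) (by omega) (by omega)
  simp only [Nat.add_sub_cancel]
  field_simp

lemma prod_column_last (h : TriangleStep n κ old new d) (hn : 1 ≤ n) :
    ∏ j ∈ Finset.Icc 1 n, old j n = κ / d n n := by
  have key : ∀ m, m + 1 ≤ n → ∏ j ∈ Finset.Icc 1 (m + 1), old j n = κ / d (m + 1) n := by
    intro m hm
    induction m with
    | zero => simp [h.old_apex]
    | succ m ih =>
      rw [Finset.prod_Icc_succ_top (by omega), ih (by omega), h.old_right _ (by omega) hm]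
      have h1 := h.pos (m + 1) n (by omega) (by omega) (by omega)
      simp only [Nat.add_sub_cancel]
      field_simp
  obtain ⟨m, rfl⟩ : ∃ m, n = m + 1 := ⟨n - 1, by omega⟩
  exact key m le_rfl

lemma prod_row_reflect (f : ℕ → ℕ → ℝ) {i : ℕ} (hi1 : 1 ≤ i) (hi : i ≤ n) :
    ∏ j ∈ Finset.Icc 1 (n + 1 - i), f (n + 1 - (n + 1 - i)) (n + 1 - j) =
      ∏ j ∈ Finset.Icc i n, f i j := by
  rw [show n + 1 - (n + 1 - i) = i by omega]
  refine Finset.prod_nbij' (fun j => n + 1 - j) (fun j => n + 1 - j) ?_ ?_ ?_ ?_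
    fun _ _ => rfl <;>
  · intro j hj
    simp only [Finset.mem_Icc] at hj ⊢
    omega

lemma prod_row (h : TriangleStep n κ old new d) {i : ℕ} (hi1 : 1 ≤ i) (hi : i < n) :
    ∏ j ∈ Finset.Icc (i + 1) n, old (i + 1) j =
      (∏ j ∈ Finset.Icc i n, new i j) * ((d i i)⁻¹ + (d (i + 1) (i + 1))⁻¹) := by
  have h1 := h.reflect.prod_column (i := n + 1 - (i + 1)) (by omega) (by omega)
  rw [prod_row_reflect old (by omega) (by omega),
    show n + 1 - (i + 1) + 1 = n + 1 - i by omega,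
    prod_row_reflect new (by omega) (by omega), show n + 1 - (n + 1 - (i + 1)) = i + 1 by omega,
    show n + 1 - (n + 1 - i) = i by omega] at h1
  rw [h1, add_comm (d i i)⁻¹]

lemma prod_row_first (h : TriangleStep n κ old new d) (hn : 1 ≤ n) :
    ∏ j ∈ Finset.Icc 1 n, old 1 j = κ / d 1 1 := by
  have h1 := h.reflect.prod_column_last hn
  have h2 := prod_row_reflect old (n := n) (i := 1) le_rfl hn
  simp only [Nat.add_sub_cancel, show n + 1 - n = 1 by omega] at h1 h2
  rw [← h2, h1]

end TriangleStep

end Triangle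

section RootPoset

variable {n : ℕ}

/-- The interval `[i, j]` as an element of `Aⁿ`. -/
def AnP.mk (i j : ℕ) (h : 1 ≤ i ∧ i ≤ j ∧ j ≤ n) : AnP n := ⟨(i, j), h⟩

/-- The left endpoint of an interval. -/
def AnP.lo (x : AnP n) : ℕ := x.val.1

/-- The right endpoint of an interval. -/
def AnP.hi (x : AnP n) : ℕ := x.val.2

@[simp] lemma AnP.lo_mk {i j : ℕ} (h : 1 ≤ i ∧ i ≤ j ∧ j ≤ n) : (AnP.mk i j h).lo = i := rfl

@[simp] lemma AnP.hi_mk {i j : ℕ} (h : 1 ≤ i ∧ i ≤ j ∧ j ≤ n) : (AnP.mk i j h).hi = j := rfl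

lemma AnP.bounds (x : AnP n) : 1 ≤ x.lo ∧ x.lo ≤ x.hi ∧ x.hi ≤ n := x.2

lemma rkAn_eq (x : AnP n) : rkAn n x = x.hi - x.lo := rfl

/-- A labeling of `Aⁿ` as a function of the endpoints, with value `0` outside the triangle. -/
noncomputable def ofEndpoints (f : AnP n → ℝ) (i j : ℕ) : ℝ :=
  if h : 1 ≤ i ∧ i ≤ j ∧ j ≤ n then f (AnP.mk i j h) else 0

lemma ofEndpoints_apply (f : AnP n → ℝ) {i j : ℕ} (h : 1 ≤ i ∧ i ≤ j ∧ j ≤ n) :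
    ofEndpoints f i j = f (AnP.mk i j h) := dif_pos h

lemma ofEndpoints_lo_hi (f : AnP n → ℝ) (x : AnP n) : ofEndpoints f x.lo x.hi = f x :=
  ofEndpoints_apply f x.bounds

lemma AnP.le_def (x y : AnP n) : x ≤ y ↔ y.lo ≤ x.lo ∧ x.hi ≤ y.hi := Iff.rfl

lemma AnP.ext_iff (x y : AnP n) : x = y ↔ x.lo = y.lo ∧ x.hi = y.hi :=
  Subtype.ext_iff.trans Prod.ext_iff

lemma AnP.lt_def (x y : AnP n) : x < y ↔ y.lo ≤ x.lo ∧ x.hi ≤ y.hi ∧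
    (y.lo < x.lo ∨ x.hi < y.hi) := by
  rw [lt_iff_le_not_ge, AnP.le_def, AnP.le_def]
  omega

lemma AnP.covBy_iff (y x : AnP n) : y ⋖ x ↔
    (y.lo = x.lo + 1 ∧ y.hi = x.hi) ∨ (y.lo = x.lo ∧ y.hi + 1 = x.hi) := by
  have hx := x.bounds
  have hy := y.bounds
  constructor
  · rintro ⟨h1, h2⟩
    rw [AnP.lt_def] at h1
    by_contra hne
    by_cases hi : x.lo < y.lo
    · refine h2 (c := AnP.mk (y.lo - 1) y.hi (by omega)) ?_ ?_ <;>
      · rw [AnP.lt_def, AnP.lo_mk, AnP.hi_mk]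
        omega
    · refine h2 (c := AnP.mk y.lo (y.hi + 1) (by omega)) ?_ ?_ <;>
      · rw [AnP.lt_def, AnP.lo_mk, AnP.hi_mk]
        omega
  · intro h
    refine ⟨?_, ?_⟩
    · rw [AnP.lt_def]
      omega
    · intro z h1 h2
      rw [AnP.lt_def] at h1 h2
      omega

lemma AnP.isMin_of_eq {x : AnP n} (h : x.lo = x.hi) : IsMin x := by
  intro y hy
  rw [AnP.le_def] at hy ⊢
  have := y.bounds
  omega

lemma AnP.not_isMin_of_lt {x : AnP n} (h : x.lo < x.hi) : ¬ IsMin x := by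
  have hx := x.bounds
  rw [not_isMin_iff]
  refine ⟨AnP.mk x.lo x.lo (by omega), ?_⟩
  rw [AnP.lt_def, AnP.lo_mk, AnP.hi_mk]
  omega

lemma AnP.isMax_of_eq {x : AnP n} (h1 : x.lo = 1) (h2 : x.hi = n) : IsMax x := by
  intro y hy
  rw [AnP.le_def] at hy ⊢
  have := y.bounds
  omega

lemma AnP.not_isMax_of_lt {x : AnP n} (h : 1 < x.lo ∨ x.hi < n) : ¬ IsMax x := by
  have hx := x.bounds
  rw [not_isMax_iff]
  refine ⟨AnP.mk 1 n (by omega), ?_⟩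
  rw [AnP.lt_def, AnP.lo_mk, AnP.hi_mk]
  omega

lemma strictMono_rkAn : StrictMono (rkAn n) := by
  intro x y h
  rw [AnP.lt_def] at h
  have := x.bounds
  have := y.bounds
  rw [rkAn_eq, rkAn_eq]
  omega

lemma rkAn_le (x : AnP n) : rkAn n x ≤ n - 1 := by
  have := x.bounds
  rw [rkAn_eq]
  omega

lemma rkAn_of_covBy (x y : AnP n) (h : y ⋖ x) : rkAn n x = rkAn n y + 1 := by
  rw [AnP.covBy_iff] at h
  have := x.bounds
  have := y.bounds
  rw [rkAn_eq, rkAn_eq]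
  omega

lemma lowerTransfer_of_eq (π : AnP n → ℝ) {x : AnP n} (h : x.lo = x.hi) :
    lowerTransfer π x = π x := by
  rw [lowerTransfer, lowerSum_of_isMin _ (AnP.isMin_of_eq h), mul_one]

lemma sum_covBy_below (f : AnP n → ℝ) {i j : ℕ} (h : 1 ≤ i ∧ i ≤ j ∧ j ≤ n) (hij : i < j) :
    ∑ y ∈ Finset.univ.filter (· ⋖ AnP.mk i j h), f y =
      ofEndpoints f (i + 1) j + ofEndpoints f i (j - 1) := by
  rw [ofEndpoints_apply f (by omega), ofEndpoints_apply f (by omega), ← Finset.sum_pair]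
  · refine Finset.sum_congr (Finset.ext fun y => ?_) fun _ _ => rfl
    simp only [Finset.mem_filter, Finset.mem_univ, true_and, Finset.mem_insert,
      Finset.mem_singleton, AnP.covBy_iff, AnP.ext_iff, AnP.lo_mk, AnP.hi_mk]
    omega
  · simp [AnP.ext_iff]

lemma sum_covBy_above_inner (f : AnP n → ℝ) {i j : ℕ} (h : 1 ≤ i ∧ i ≤ j ∧ j ≤ n) (hi : 1 < i)
    (hj : j < n) :
    ∑ y ∈ Finset.univ.filter (AnP.mk i j h ⋖ ·), f y =
      ofEndpoints f (i - 1) j + ofEndpoints f i (j + 1) := by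
  rw [ofEndpoints_apply f (by omega), ofEndpoints_apply f (by omega), ← Finset.sum_pair]
  · refine Finset.sum_congr (Finset.ext fun y => ?_) fun _ _ => rfl
    simp only [Finset.mem_filter, Finset.mem_univ, true_and, Finset.mem_insert,
      Finset.mem_singleton, AnP.covBy_iff, AnP.ext_iff, AnP.lo_mk, AnP.hi_mk]
    omega
  · simp [AnP.ext_iff]

lemma sum_covBy_above_left (f : AnP n → ℝ) {j : ℕ} (h : 1 ≤ 1 ∧ 1 ≤ j ∧ j ≤ n) (hj : j < n) :
    ∑ y ∈ Finset.univ.filter (AnP.mk 1 j h ⋖ ·), f y = ofEndpoints f 1 (j + 1) := by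
  rw [ofEndpoints_apply f (by omega), ← Finset.sum_singleton f]
  refine Finset.sum_congr (Finset.ext fun y => ?_) fun _ _ => rfl
  have := y.bounds
  simp only [Finset.mem_filter, Finset.mem_univ, true_and,
    Finset.mem_singleton, AnP.covBy_iff, AnP.ext_iff, AnP.lo_mk, AnP.hi_mk]
  omega

lemma sum_covBy_above_right (f : AnP n → ℝ) {i : ℕ} (h : 1 ≤ i ∧ i ≤ n ∧ n ≤ n) (hi : 1 < i) :
    ∑ y ∈ Finset.univ.filter (AnP.mk i n h ⋖ ·), f y = ofEndpoints f (i - 1) n := by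
  rw [ofEndpoints_apply f (by omega), ← Finset.sum_singleton f]
  refine Finset.sum_congr (Finset.ext fun y => ?_) fun _ _ => rfl
  have := y.bounds
  simp only [Finset.mem_filter, Finset.mem_univ, true_and,
    Finset.mem_singleton, AnP.covBy_iff, AnP.ext_iff, AnP.lo_mk, AnP.hi_mk]
  omega

lemma triangleStep_of_transfer {κ : ℝ} (hκ : 0 < κ) (hn : 1 ≤ n) {σ τ : AnP n → ℝ}
    (hσ : ∀ x, 0 < σ x) (hτ : ∀ x, 0 < τ x)
    (h : ∀ x, lowerTransfer τ x * upperTransfer σ x = κ) :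
    TriangleStep n κ (ofEndpoints σ) (ofEndpoints τ) (ofEndpoints (lowerTransfer τ)) := by
  have hd : ∀ i j, 1 ≤ i → i ≤ j → j ≤ n → 0 < ofEndpoints (lowerTransfer τ) i j := by
    intro i j h1 h2 h3
    rw [ofEndpoints_apply _ ⟨h1, h2, h3⟩]
    exact lowerTransfer_pos hτ _
  have hup : ∀ i j, 1 ≤ i → i ≤ j → j ≤ n →
      ofEndpoints (upperTransfer σ) i j = κ / ofEndpoints (lowerTransfer τ) i j := by
    intro i j h1 h2 h3
    rw [eq_div_iff (hd i j h1 h2 h3).ne', mul_comm, ofEndpoints_apply _ ⟨h1, h2, h3⟩,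
      ofEndpoints_apply _ ⟨h1, h2, h3⟩]
    exact h _
  have hold : ∀ i j (hij : 1 ≤ i ∧ i ≤ j ∧ j ≤ n), ofEndpoints σ i j =
      κ / ofEndpoints (lowerTransfer τ) i j / upperSum σ (AnP.mk i j hij) := by
    intro i j hij
    rw [← hup i j hij.1 hij.2.1 hij.2.2, ofEndpoints_apply _ hij, ofEndpoints_apply _ hij,
      upperTransfer, mul_div_cancel_right₀ _ (upperSum_pos hσ _).ne']
  refine ⟨hd, ?_, ?_, ?_, ?_, ?_, ?_⟩
  · intro i h1 h2
    rw [ofEndpoints_apply _ ⟨h1, le_rfl, h2⟩, ofEndpoints_apply _ ⟨h1, le_rfl, h2⟩,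
      lowerTransfer_of_eq _ rfl]
  · intro i j h1 h2 h3
    rw [← sum_covBy_below _ ⟨h1, h2.le, h3⟩ h2]
    have h4 := lowerSum_of_not_isMin τ (x := AnP.mk i j ⟨h1, h2.le, h3⟩) (AnP.not_isMin_of_lt h2)
    simp only [lowerTransfer] at h4 ⊢
    rw [← h4, ofEndpoints_apply _ ⟨h1, h2.le, h3⟩, ofEndpoints_apply _ ⟨h1, h2.le, h3⟩,
      lowerTransfer, mul_div_cancel_right₀ _ (lowerSum_pos hτ _).ne']
  · rw [hold 1 n ⟨le_rfl, hn, le_rfl⟩, upperSum_of_isMax _ (AnP.isMax_of_eq rfl rfl), div_one]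
  · intro j h1 h2
    have h3 := sum_covBy_above_left (upperTransfer σ) ⟨le_rfl, h1, h2.le⟩ h2
    simp only [upperTransfer] at h3
    rw [← upperSum_of_not_isMax _ (AnP.not_isMax_of_lt (Or.inr h2))] at h3
    rw [hold 1 j ⟨le_rfl, h1, h2.le⟩, h3]
    change _ / ofEndpoints (upperTransfer σ) 1 (j + 1) = _
    rw [hup _ _ (by omega) (by omega) (by omega)]
    have h4 := hd 1 j (by omega) (by omega) (by omega)
    have h5 := hd 1 (j + 1) (by omega) (by omega) (by omega)
    field_simp
  · intro i h1 h2
    have h3 := sum_covBy_above_right (upperTransfer σ) ⟨h1.le, h2, le_rfl⟩ h1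
    simp only [upperTransfer] at h3
    rw [← upperSum_of_not_isMax _ (AnP.not_isMax_of_lt
      (x := AnP.mk i n ⟨h1.le, h2, le_rfl⟩) (Or.inl h1))] at h3
    rw [hold i n ⟨h1.le, h2, le_rfl⟩, h3]
    change _ / ofEndpoints (upperTransfer σ) (i - 1) n = _
    rw [hup _ _ (by omega) (by omega) (by omega)]
    have h4 := hd i n (by omega) (by omega) (by omega)
    have h5 := hd (i - 1) n (by omega) (by omega) (by omega)
    field_simp
  · intro i j h1 h2 h3
    have h4 := sum_covBy_above_inner (upperTransfer σ) ⟨h1.le, h2, h3.le⟩ h1 h3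
    simp only [upperTransfer] at h4
    rw [← upperSum_of_not_isMax _ (AnP.not_isMax_of_lt
      (x := AnP.mk i j ⟨h1.le, h2, h3.le⟩) (Or.inl h1))] at h4
    rw [hold i j ⟨h1.le, h2, h3.le⟩, h4]
    change _ / (ofEndpoints (upperTransfer σ) (i - 1) j +
      ofEndpoints (upperTransfer σ) i (j + 1)) = _
    rw [hup _ _ (by omega) (by omega) (by omega), hup _ _ (by omega) (by omega) (by omega)]
    have h5 := hd i j (by omega) (by omega) (by omega)
    have h6 := hd (i - 1) j (by omega) (by omega) (by omega)
    have h7 := hd i (j + 1) (by omega) (by omega) (by omega)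
    field_simp

lemma hB_eq (i : ℕ) (hi1 : 1 ≤ i) (hi2 : i ≤ n) (π : AnP n → ℝ) :
    hB n i π = (∏ j ∈ Finset.Icc i n, ofEndpoints π i j) *
      ∏ j ∈ Finset.Icc 1 i, ofEndpoints π j i := by
  unfold hB
  congr 1
  · change ∏ p : AnP n with p.lo = i, π p = _
    refine Finset.prod_bij (fun p _ => p.hi) ?_ ?_ ?_ ?_
    · intro p hp
      have := p.bounds
      rw [Finset.mem_filter_univ] at hp
      rw [Finset.mem_Icc]
      omega
    · intro p hp q hq h
      rw [Finset.mem_filter_univ] at hp hq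
      exact (AnP.ext_iff p q).2 ⟨hp.trans hq.symm, h⟩
    · intro j hj
      rw [Finset.mem_Icc] at hj
      exact ⟨AnP.mk i j ⟨hi1, hj⟩, by simp, rfl⟩
    · intro p hp
      rw [Finset.mem_filter_univ] at hp
      rw [← hp, ofEndpoints_lo_hi]
  · change ∏ p : AnP n with p.hi = i, π p = _
    refine Finset.prod_bij (fun p _ => p.lo) ?_ ?_ ?_ ?_
    · intro p hp
      have := p.bounds
      rw [Finset.mem_filter_univ] at hp
      rw [Finset.mem_Icc]
      omega
    · intro p hp q hq h
      rw [Finset.mem_filter_univ] at hp hq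
      exact (AnP.ext_iff p q).2 ⟨h, hp.trans hq.symm⟩
    · intro j hj
      rw [Finset.mem_Icc] at hj
      exact ⟨AnP.mk j i ⟨hj.1, hj.2, hi2⟩, by simp, rfl⟩
    · intro p hp
      rw [Finset.mem_filter_univ] at hp
      rw [← hp, ofEndpoints_lo_hi]

variable {κ : ℝ}

lemma triangleStep_RowAB (hκ : 0 < κ) (hn : 1 ≤ n) {π : AnP n → ℝ} (hπ : ∀ x, 0 < π x) :
    TriangleStep n κ (ofEndpoints π) (ofEndpoints (RowAB κ (rkAn n) (n - 1) π))
      (ofEndpoints (lowerTransfer (RowAB κ (rkAn n) (n - 1) π))) :=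
  triangleStep_of_transfer hκ hn hπ (RowAB_pos hκ strictMono_rkAn _ hπ)
    (lowerTransfer_RowAB_mul hκ strictMono_rkAn rkAn_le hπ)

lemma triangleStep_LKB (hκ : 0 < κ) (hn : 1 ≤ n) {π : AnP n → ℝ} (hπ : ∀ x, 0 < π x) :
    TriangleStep n κ (ofEndpoints (LKB n κ (RowAB κ (rkAn n) (n - 1) π)))
      (ofEndpoints (LKB n κ π)) (ofEndpoints (lowerTransfer (LKB n κ π))) :=
  triangleStep_of_transfer hκ hn
    (RvacAB_pos hκ strictMono_rkAn rkAn_le rkAn_of_covBy (RowAB_pos hκ strictMono_rkAn _ hπ))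
    (RvacAB_pos hκ strictMono_rkAn rkAn_le rkAn_of_covBy hπ)
    (lowerTransfer_RvacAB_mul hκ strictMono_rkAn rkAn_le rkAn_of_covBy hπ)

lemma lowerTransfer_LKB_diag (hκ : 0 < κ) {π : AnP n → ℝ} (hπ : ∀ x, 0 < π x) {i : ℕ}
    (hi1 : 1 ≤ i) (hi2 : i ≤ n) :
    ofEndpoints (lowerTransfer (LKB n κ π)) i i =
      ofEndpoints (lowerTransfer (RowAB κ (rkAn n) (n - 1) π)) i i := by
  rw [ofEndpoints_apply _ ⟨hi1, le_rfl, hi2⟩, ofEndpoints_apply _ ⟨hi1, le_rfl, hi2⟩, LKB,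
    lowerTransfer_RvacAB hκ strictMono_rkAn rkAn_le rkAn_of_covBy hπ]
  simp [rkAn_eq]

lemma prod_row_LKB_mul_prod_column (hκ : 0 < κ) (i m : ℕ) (hi1 : 1 ≤ i) (him : i + m = n)
    {π : AnP n → ℝ} (hπ : ∀ x, 0 < π x) :
    (∏ j ∈ Finset.Icc i n, ofEndpoints (LKB n κ π) i j) *
      ∏ j ∈ Finset.Icc 1 i, ofEndpoints π j i = κ := by
  have hn : 1 ≤ n := by omega
  have hrow := triangleStep_RowAB hκ hn hπ
  have hlk := triangleStep_LKB hκ hn hπ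
  induction m generalizing i π with
  | zero =>
    obtain rfl : i = n := him
    rw [hrow.prod_column_last hn, Finset.Icc_self, Finset.prod_singleton,
      hlk.new_diag i hi1 le_rfl, lowerTransfer_LKB_diag hκ hπ hi1 le_rfl]
    exact mul_div_cancel₀ _ (hrow.pos i i hi1 le_rfl le_rfl).ne'
  | succ m ih =>
    have hπ' := RowAB_pos hκ strictMono_rkAn (n - 1) hπ
    have h1 := ih (i + 1) (by omega) (by omega) hπ' (triangleStep_RowAB hκ hn hπ')
      (triangleStep_LKB hκ hn hπ')
    rw [hlk.prod_row hi1 (by omega), lowerTransfer_LKB_diag hκ hπ hi1 (by omega),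
      lowerTransfer_LKB_diag hκ hπ (i := i + 1) (by omega) (by omega)] at h1
    rw [hrow.prod_column hi1 (by omega)]
    refine Eq.trans ?_ h1
    ring

lemma prod_column_LKB_mul_prod_row (hκ : 0 < κ) (i : ℕ) (hi1 : 1 ≤ i) (hi2 : i ≤ n)
    {π : AnP n → ℝ} (hπ : ∀ x, 0 < π x) :
    (∏ j ∈ Finset.Icc 1 i, ofEndpoints (LKB n κ π) j i) *
      ∏ j ∈ Finset.Icc i n, ofEndpoints π i j = κ := by
  have hn : 1 ≤ n := by omega
  have hrow := triangleStep_RowAB hκ hn hπ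
  have hlk := triangleStep_LKB hκ hn hπ
  induction i, hi1 using Nat.le_induction generalizing π with
  | base =>
    rw [hrow.prod_row_first hn, Finset.Icc_self, Finset.prod_singleton,
      hlk.new_diag 1 le_rfl hn, lowerTransfer_LKB_diag hκ hπ le_rfl hn]
    exact mul_div_cancel₀ _ (hrow.pos 1 1 le_rfl le_rfl hn).ne'
  | succ i hi1 ih =>
    have hπ' := RowAB_pos hκ strictMono_rkAn (n - 1) hπ
    have h1 := ih (by omega) hπ' (triangleStep_RowAB hκ hn hπ') (triangleStep_LKB hκ hn hπ')
    rw [hlk.prod_column hi1 (by omega), lowerTransfer_LKB_diag hκ hπ hi1 (by omega),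
      lowerTransfer_LKB_diag hκ hπ (i := i + 1) (by omega) hi2] at h1
    rw [hrow.prod_row hi1 (by omega)]
    refine Eq.trans ?_ h1
    ring

end RootPoset

/-- For every `n ≥ 1`, `κ > 0`, every `π : Aⁿ → ℝ>0` and every
`1 ≤ i ≤ n`, `h^B_i(π) · h^B_i(LK^B π) = κ²`; i.e. each `h^B_i` is multiplicatively
`κ`-mesic for the birational Lalanne–Kreweras involution. -/
theorem stmt9 (n : ℕ) (hn : 1 ≤ n) (κ : ℝ) (hκ : 0 < κ)
    (π : AnP n → ℝ) (hpos : ∀ p, 0 < π p)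
    (i : ℕ) (hi1 : 1 ≤ i) (hi2 : i ≤ n) :
    hB n i π * hB n i (LKB n κ π) = κ ^ 2 := by
  rw [hB_eq i hi1 hi2, hB_eq i hi1 hi2]
  have h1 := prod_row_LKB_mul_prod_column hκ i (n - i) hi1 (by omega) hpos
  have h2 := prod_column_LKB_mul_prod_row hκ i hi1 hi2 hpos
  linear_combination (∏ j ∈ Finset.Icc 1 i, ofEndpoints (LKB n κ π) j i) *
    (∏ j ∈ Finset.Icc i n, ofEndpoints π i j) * h1 + κ * h2
end
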